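/- Suppose a > 0 (b ∈ ℝ arbitrary). Then there exists a random variable C whose distribution is Gaussian with strictly positive variance such that, almost surely, lim_{t→∞} X(t) / ( e^{at} t^{b/a} ) = C; moreover lim_{t→∞} E[X(t)] / ( e^{at} t^{b/a} ) = E[C] and lim_{t→∞} Var[X(t)] / ( e^{2at} t^{2b/a} ) = Var[C]. -/

import Mathlib

open MeasureTheory ProbabilityTheory Filter Real Set

noncomputable section

/-- `B` is a standard one-dimensional Brownian motion adapted to the filtration `F`
under the probability measure `P`: all paths are continuous and start at `0`, the
increment `B t - B s` is Gaussian with mean `0` and variance `t - s`, and increments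
after time `s` are independent of `F s`. -/
def IsStdBrownian {Ω : Type*} {mΩ : MeasurableSpace Ω} (P : Measure Ω)
    (F : MeasureTheory.Filtration ℝ mΩ) (B : ℝ → Ω → ℝ) : Prop :=
  MeasureTheory.Adapted F B ∧
  (∀ ω, B 0 ω = 0) ∧
  (∀ ω, Continuous fun t => B t ω) ∧
  (∀ s t : ℝ, 0 ≤ s → s ≤ t →
    P.map (fun ω => B t ω - B s ω) = gaussianReal 0 (Real.toNNReal (t - s))) ∧
  (∀ s t : ℝ, 0 ≤ s → s ≤ t →
    Indep (MeasurableSpace.comap (fun ω => B t ω - B s ω) Real.measurableSpace) (F s) P)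

/-- `X` is the (continuous, adapted) solution of the affine stochastic functional
differential equation `dX(t) = (a X(t) + b/(1+t) ∫_{-1}^t X(s) ds) dt + σ dB(t)` for
`t ≥ 0`, with initial history `ψ` on `[-1, 0]`; i.e. almost surely, for all `t ≥ 0`,
`X t = ψ 0 + ∫_0^t (a X(s) + b/(1+s) (∫_{-1}^0 ψ(u) du + ∫_0^s X(u) du)) ds + σ B t`. -/
def IsSolutionSFDE {Ω : Type*} {mΩ : MeasurableSpace Ω} (P : Measure Ω)
    (F : MeasureTheory.Filtration ℝ mΩ) (a b σ : ℝ) (ψ : ℝ → ℝ)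
    (B X : ℝ → Ω → ℝ) : Prop :=
  (∀ t : ℝ, 0 ≤ t → StronglyMeasurable[F t] (X t)) ∧
  (∀ ω, ContinuousOn (fun t => X t ω) (Set.Ici (0 : ℝ))) ∧
  (∀ᵐ ω ∂P, ∀ t : ℝ, 0 ≤ t →
    X t ω = ψ 0
      + (∫ s in (0:ℝ)..t,
          (a * X s ω + b / (1 + s) * ((∫ u in (-1:ℝ)..(0:ℝ), ψ u) + ∫ u in (0:ℝ)..s, X u ω)))
      + σ * B t ω)

theorem sqrt_energy_le {L L' n : ℝ → ℝ} {c : ℝ} (hc : 0 ≤ c) (hLc : Continuous L)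
    (hL0 : ∀ t, 0 ≤ L t) (hL : ∀ t, 0 < t → HasDerivAt L (L' t) t) (hn : Continuous n)
    (hn0 : ∀ t, 0 ≤ n t)
    (h : ∀ t, 0 < t → L' t ≤ 2 * √(L t) * n t + c / (1 + t) ^ 2 * L t) {t : ℝ} (ht : 0 ≤ t) :
    √(L t) ≤ exp (c / 2) * (√(L 0) + ∫ s in (0:ℝ)..t, n s) := by
  have hN (s : ℝ) : HasDerivAt (fun t => ∫ s in (0:ℝ)..t, n s) (n s) s :=
    hn.integral_hasStrictDerivAt 0 s |>.hasDerivAt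
  have key : ∀ ε : ℝ, 0 < ε →
      √(L t) ≤ exp (c / 2) * (√(L 0) + ∫ s in (0:ℝ)..t, n s) + exp (c / 2) * ε := by
    intro ε hε
    set q : ℝ → ℝ := fun s => √(L s + ε ^ 2) with hq
    set φ : ℝ → ℝ := fun s => exp (c / 2 * ((1 + |s|)⁻¹ - 1)) with hφ
    have hqpos (s : ℝ) : 0 < q s := Real.sqrt_pos.2 (by have := hL0 s; positivity)
    have hφpos (s : ℝ) : 0 < φ s := exp_pos _
    have hφle (s : ℝ) : φ s ≤ 1 := by
      apply Real.exp_le_one_iff.2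
      have : (1 + |s|)⁻¹ ≤ 1 := inv_le_one_of_one_le₀ (by simp)
      nlinarith
    have hφge (s : ℝ) : exp (-(c / 2)) ≤ φ s := by
      apply Real.exp_le_exp.2
      have : 0 ≤ (1 + |s|)⁻¹ := by positivity
      nlinarith
    have hφc : Continuous φ := by
      have : ∀ s : ℝ, 1 + |s| ≠ 0 := fun s => by positivity
      fun_prop (disch := exact this _)
    have hqc : Continuous q := by fun_prop
    have hφd (s : ℝ) (hs : 0 < s) : HasDerivAt φ (φ s * (c / 2 * (-1 / (1 + s) ^ 2))) s := by
      have h1 : HasDerivAt (fun s : ℝ => exp (c / 2 * ((1 + s)⁻¹ - 1)))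
          (exp (c / 2 * ((1 + s)⁻¹ - 1)) * (c / 2 * (-1 / (1 + s) ^ 2))) s :=
        (((((hasDerivAt_id s).const_add 1).inv (by simp; positivity)).sub_const 1).const_mul
          (c / 2)).exp
      have h2 : φ =ᶠ[nhds s] fun s : ℝ => exp (c / 2 * ((1 + s)⁻¹ - 1)) := by
        filter_upwards [lt_mem_nhds hs] with r hr
        simp [hφ, abs_of_pos hr]
      have h3 : φ s = exp (c / 2 * ((1 + s)⁻¹ - 1)) := by simp [hφ, abs_of_pos hs]
      rw [h3]
      exact h1.congr_of_eventuallyEq h2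
    have hqd (s : ℝ) (hs : 0 < s) : HasDerivAt q (L' s / (2 * q s)) s :=
      ((hL s hs).add_const _).sqrt (by have := hL0 s; positivity)
    have hanti : AntitoneOn (fun s => q s * φ s - ∫ r in (0:ℝ)..s, n r) (Ici 0) := by
      apply antitoneOn_of_hasDerivWithinAt_nonpos (convex_Ici 0)
        (f' := fun s => L' s / (2 * q s) * φ s + q s * (φ s * (c / 2 * (-1 / (1 + s) ^ 2))) - n s)
      · exact ((hqc.mul hφc).sub
          (continuous_iff_continuousAt.2 fun s => (hN s).continuousAt)).continuousOn
      · intro s hs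
        rw [interior_Ici] at hs
        exact (((hqd s hs).mul (hφd s hs)).sub (hN s)).hasDerivWithinAt
      · intro s hs
        rw [interior_Ici] at hs
        have hs : 0 < s := hs
        have hq2 : q s ^ 2 = L s + ε ^ 2 := Real.sq_sqrt (by have := hL0 s; positivity)
        have hsq : √(L s) ≤ q s := Real.sqrt_le_sqrt (by nlinarith)
        have hb : L' s / (2 * q s) ≤ n s + c / 2 * (1 / (1 + s) ^ 2) * q s := by
          rw [div_le_iff₀ (by have := hqpos s; positivity)]
          have e1 : 2 * √(L s) * n s ≤ 2 * q s * n s := by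
            have := hn0 s; gcongr
          have e2 : c / (1 + s) ^ 2 * L s ≤ c / (1 + s) ^ 2 * q s ^ 2 := by
            gcongr; nlinarith
          have := h s hs
          calc L' s ≤ 2 * q s * n s + c / (1 + s) ^ 2 * q s ^ 2 := by linarith
            _ = _ := by ring
        have e3 : L' s / (2 * q s) * φ s ≤ (n s + c / 2 * (1 / (1 + s) ^ 2) * q s) * φ s := by
          have := hφpos s; gcongr
        have e4 : n s * φ s ≤ n s := mul_le_of_le_one_right (hn0 s) (hφle s)
        have e5 : q s * (φ s * (c / 2 * (-1 / (1 + s) ^ 2)))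
          = - (c / 2 * (1 / (1 + s) ^ 2) * q s * φ s) := by ring
        linarith
    have h0 := hanti (mem_Ici.2 le_rfl) (mem_Ici.2 ht) ht
    simp only [intervalIntegral.integral_same, sub_zero] at h0
    have hq0 : q 0 ≤ √(L 0) + ε := by
      rw [hq, Real.sqrt_le_left (by positivity)]
      nlinarith [Real.sq_sqrt (hL0 0), Real.sqrt_nonneg (L 0)]
    have hφ0 : φ 0 = 1 := by simp [hφ]
    rw [hφ0, mul_one] at h0
    have h1 : √(L t) ≤ q t := Real.sqrt_le_sqrt (by nlinarith)
    have h2 : q t * exp (-(c / 2)) ≤ √(L 0) + ε + ∫ s in (0:ℝ)..t, n s := by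
      have : q t * exp (-(c / 2)) ≤ q t * φ t := by
        have := hqpos t; gcongr; exact hφge t
      linarith
    rw [Real.exp_neg, ← div_eq_mul_inv, div_le_iff₀ (exp_pos _)] at h2
    linarith
  refine le_of_forall_pos_le_add fun ε hε => ?_
  have := key (ε / exp (c / 2)) (by positivity)
  rwa [mul_div_cancel₀ _ (exp_pos _).ne'] at this

/-- The weight `e^{-at} (1+|t|)^{-β}`. -/
def damp (a β t : ℝ) : ℝ := exp (-(a * t)) * (1 + |t|) ^ (-β)

theorem damp_pos (a β t : ℝ) : 0 < damp a β t := by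
  unfold damp; positivity

theorem continuous_damp (a β : ℝ) : Continuous (damp a β) := by
  unfold damp
  refine (by fun_prop : Continuous fun t : ℝ => exp (-(a * t))).mul ?_
  refine Continuous.rpow_const (by fun_prop) fun t => Or.inl (by positivity)

theorem hasDerivAt_damp (a β : ℝ) {t : ℝ} (ht : 0 < t) :
    HasDerivAt (damp a β) (-(a + β / (1 + t)) * damp a β t) t := by
  have h1 : HasDerivAt (fun s : ℝ => exp (-(a * s)) * (1 + s) ^ (-β))
      (exp (-(a * t)) * (-(a * 1)) * (1 + t) ^ (-β)
        + exp (-(a * t)) * (1 * (-β) * (1 + t) ^ (-β - 1))) t :=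
    (((hasDerivAt_id t).const_mul a).neg.exp).mul
      (((hasDerivAt_id t).const_add 1).rpow_const (Or.inl (by simp; positivity)))
  have h2 : damp a β =ᶠ[nhds t] fun s : ℝ => exp (-(a * s)) * (1 + s) ^ (-β) := by
    filter_upwards [lt_mem_nhds ht] with r hr
    simp [damp, abs_of_pos hr]
  refine (h1.congr_of_eventuallyEq h2).congr_deriv ?_
  rw [h2.self_of_nhds, Real.rpow_sub_one (by positivity)]
  field_simp
  ring

/-- `Y` and `I` solve `Y' = aY + af + bI/(1+t)`, `I' = Y + f` on `(0, ∞)`. -/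
structure IsForcedSol (a b : ℝ) (f Y I : ℝ → ℝ) : Prop where
  cf : Continuous f
  cY : Continuous Y
  cI : Continuous I
  hY : ∀ t, 0 < t → HasDerivAt Y (a * Y t + a * f t + b / (1 + t) * I t) t
  hI : ∀ t, 0 < t → HasDerivAt I (Y t + f t) t

theorem energy_deriv_le {a β τ v w n p q r P Q R : ℝ} (ha : 0 < a)
    (hp : |p| ≤ P) (hq : |q| ≤ Q) (hr : |r| ≤ R) :
    2 * w * (n + (p * v + q * w) / τ ^ 2) + 2 * v * (-(a + r / τ) * v - β / τ * w)
      ≤ 2 * √(w ^ 2 + v ^ 2) * |n|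
        + (P + 2 * Q + R ^ 2 / a + β ^ 2 / a) / τ ^ 2 * (w ^ 2 + v ^ 2) := by
  have h1 : w * n ≤ √(w ^ 2 + v ^ 2) * |n| := by
    have : |w| ≤ √(w ^ 2 + v ^ 2) := Real.abs_le_sqrt (by nlinarith)
    calc w * n ≤ |w * n| := le_abs_self _
      _ = |w| * |n| := abs_mul _ _
      _ ≤ _ := by gcongr
  have hP : 0 ≤ P := (abs_nonneg _).trans hp
  have hQ : 0 ≤ Q := (abs_nonneg _).trans hq
  have h2 : 2 * (p * v * w) ≤ P * (w ^ 2 + v ^ 2) := by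
    have e1 : p * v * w ≤ |p| * (|v| * |w|) := by
      rw [← abs_mul, ← abs_mul, ← mul_assoc]; exact le_abs_self _
    have e2 : |p| * (|v| * |w|) ≤ P * (|v| * |w|) := by gcongr
    have e3 : 2 * (|v| * |w|) ≤ w ^ 2 + v ^ 2 := by
      nlinarith [sq_nonneg (|v| - |w|), sq_abs v, sq_abs w]
    nlinarith
  have h3 : q * w ^ 2 ≤ Q * (w ^ 2 + v ^ 2) := by
    have e1 : q * w ^ 2 ≤ Q * w ^ 2 := by gcongr; exact (le_abs_self _).trans hq
    nlinarith [mul_nonneg hQ (sq_nonneg v)]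
  have hr2 : r ^ 2 ≤ R ^ 2 := sq_le_sq' (by linarith [neg_abs_le r]) ((le_abs_self _).trans hr)
  have h4 : -2 * (r / τ) * v ^ 2 - a * v ^ 2 ≤ R ^ 2 / a / τ ^ 2 * (w ^ 2 + v ^ 2) := by
    have e1 : 0 ≤ (a + r / τ) ^ 2 / a * v ^ 2 := by positivity
    have e2 : (a + r / τ) ^ 2 / a * v ^ 2
        = a * v ^ 2 + 2 * (r / τ) * v ^ 2 + r ^ 2 / a / τ ^ 2 * v ^ 2 := by
      field_simp
      ring
    have e3 : r ^ 2 / a / τ ^ 2 * v ^ 2 ≤ R ^ 2 / a / τ ^ 2 * v ^ 2 := by gcongr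
    have e4 : R ^ 2 / a / τ ^ 2 * v ^ 2 ≤ R ^ 2 / a / τ ^ 2 * (w ^ 2 + v ^ 2) := by
      gcongr; nlinarith
    linarith
  have h5 : -2 * (β / τ) * v * w - a * v ^ 2 ≤ β ^ 2 / a / τ ^ 2 * (w ^ 2 + v ^ 2) := by
    have e1 : 0 ≤ (a * v + β / τ * w) ^ 2 / a := by positivity
    have e2 : (a * v + β / τ * w) ^ 2 / a
        = a * v ^ 2 + 2 * (β / τ) * v * w + β ^ 2 / a / τ ^ 2 * w ^ 2 := by
      field_simp
      ring
    have e4 : β ^ 2 / a / τ ^ 2 * w ^ 2 ≤ β ^ 2 / a / τ ^ 2 * (w ^ 2 + v ^ 2) := by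
      gcongr; nlinarith
    linarith
  have h23 : 2 * (p * v * w + q * w ^ 2) / τ ^ 2 ≤ (P + 2 * Q) / τ ^ 2 * (w ^ 2 + v ^ 2) := by
    rw [div_mul_eq_mul_div]
    exact div_le_div_of_nonneg_right (by linarith) (sq_nonneg _)
  calc _ = 2 * (w * n) + 2 * (p * v * w + q * w ^ 2) / τ ^ 2
        + (-2 * (r / τ) * v ^ 2 - a * v ^ 2) + (-2 * (β / τ) * v * w - a * v ^ 2) := by ring
    _ ≤ 2 * (√(w ^ 2 + v ^ 2) * |n|) + (P + 2 * Q) / τ ^ 2 * (w ^ 2 + v ^ 2)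
        + R ^ 2 / a / τ ^ 2 * (w ^ 2 + v ^ 2) + β ^ 2 / a / τ ^ 2 * (w ^ 2 + v ^ 2) := by linarith
    _ = _ := by ring

/-- The fast (growing) mode, up to an error of lower order. -/
def growMode (a b : ℝ) (Y I : ℝ → ℝ) (t : ℝ) : ℝ :=
  damp a (b / a) t * Y t
    + b / a / a / (1 + |t|) * (damp a (b / a) t * (a * I t - Y t))

/-- The size of the data driving a forced solution up to time `t`. -/
def forcedSize (a b : ℝ) (f Y I : ℝ → ℝ) (t : ℝ) : ℝ :=
  |Y 0| + |I 0| + ∫ s in (0:ℝ)..t, damp a (b / a) s * |f s|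

set_option maxHeartbeats 1000000 in
theorem forced_estimates {a : ℝ} (b : ℝ) (ha : 0 < a) : ∃ K : ℝ, 0 < K ∧
    ∀ f Y I : ℝ → ℝ, IsForcedSol a b f Y I → ∀ t, 0 ≤ t →
      damp a (b / a) t * |Y t| ≤ K * forcedSize a b f Y I t ∧
      damp a (b / a) t * |a * I t - Y t| ≤ K * forcedSize a b f Y I t ∧
      (0 < t → ∃ ρ, |ρ| ≤ K * forcedSize a b f Y I t ∧
        HasDerivAt (growMode a b Y I) (a * (damp a (b / a) t * f t) + ρ / (1 + t) ^ 2) t) := by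
  set β := b / a with hβ
  have hb : b = β * a := by rw [hβ]; field_simp
  set γ := β / a with hγ
  have hγa : γ * a = β := by rw [hγ]; field_simp
  set P := |γ| + 2 * |β * γ| + |β| * γ ^ 2 with hP
  set Q := |β * γ| with hQ
  set R := 2 * |β| + |β * γ| with hR
  set c := P + 2 * Q + R ^ 2 / a + β ^ 2 / a with hc
  have hP0 : 0 ≤ P := by positivity
  have hQ0 : 0 ≤ Q := by positivity
  have hc0 : 0 ≤ c := by positivity
  set K₂ := exp (c / 2) * ((1 + (|γ| + 1) * (a + 1)) + a) with hK₂
  have hK₂0 : 0 < K₂ := by positivity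
  refine ⟨(1 + |γ| + P + Q) * K₂, by positivity, fun f Y I h t ht => ?_⟩
  set d := damp a β with hd
  have hdpos (s : ℝ) : 0 < d s := damp_pos _ _ _
  have hdc : Continuous d := continuous_damp _ _
  have hfc := h.cf
  have hYc := h.cY
  have hIc := h.cI
  set v : ℝ → ℝ := fun s => d s * (a * I s - Y s) with hv
  set w : ℝ → ℝ := growMode a b Y I with hw
  have hw' (s : ℝ) : w s = d s * Y s + γ / (1 + |s|) * v s := rfl
  have hvc : Continuous v := by fun_prop
  have hwc : Continuous w := by
    have : ∀ s : ℝ, 1 + |s| ≠ 0 := fun s => by positivity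
    rw [funext hw']
    fun_prop (disch := exact this _)
  have hτ {s : ℝ} (hs : 0 < s) : 1 / (1 + s) ≤ 1 := by
    rw [div_le_one (by positivity)]; linarith
  have hvd (s : ℝ) (hs : 0 < s) :
      HasDerivAt v (-(a + (2 * β - β * γ / (1 + s)) / (1 + s)) * v s - β / (1 + s) * w s) s := by
    refine ((hasDerivAt_damp a β hs).mul (((h.hI s hs).const_mul a).sub (h.hY s hs))).congr_deriv ?_
    rw [hw', abs_of_pos hs, ← hd, hb, ← hγa]
    simp only [hv, Pi.sub_apply]
    field_simp
    ring
  have hwd (s : ℝ) (hs : 0 < s) :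
      HasDerivAt w (a * (d s * f s) + ((-(γ + 2 * β * γ) + β * γ ^ 2 / (1 + s)) * v s
        + -(β * γ) * w s) / (1 + s) ^ 2) s := by
    have e1 : HasDerivAt (fun r : ℝ => γ / (1 + r)) (-γ / (1 + s) ^ 2) s := by
      refine ((hasDerivAt_const s γ).div ((hasDerivAt_id s).const_add 1)
        (by simp; positivity)).congr_deriv ?_
      simp
    have e2 : w =ᶠ[nhds s] fun r => d r * Y r + γ / (1 + r) * v r := by
      filter_upwards [lt_mem_nhds hs] with r hr
      rw [hw', abs_of_pos hr]
    refine ((((hasDerivAt_damp a β hs).mul (h.hY s hs)).add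
      (e1.mul (hvd s hs))).congr_of_eventuallyEq e2).congr_deriv ?_
    rw [hw', abs_of_pos hs, ← hd, hb, ← hγa]
    simp only [hv]
    field_simp
    ring
  have hp {s : ℝ} (hs : 0 < s) : |-(γ + 2 * β * γ) + β * γ ^ 2 / (1 + s)| ≤ P := by
    have e1 : |β * γ ^ 2 / (1 + s)| ≤ |β| * γ ^ 2 := by
      rw [abs_div, abs_mul, abs_of_nonneg (sq_nonneg γ), abs_of_pos (by linarith : 0 < 1 + s)]
      exact div_le_self (by positivity) (by linarith)
    have e2 : |γ + 2 * β * γ| ≤ |γ| + 2 * |β * γ| := by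
      refine (abs_add_le _ _).trans ?_
      rw [mul_assoc, abs_mul 2, abs_two]
    refine (abs_add_le _ _).trans ?_
    rw [abs_neg]
    linarith
  have hq : |-(β * γ)| ≤ Q := by rw [abs_neg]
  have hr {s : ℝ} (hs : 0 < s) : |2 * β - β * γ / (1 + s)| ≤ R := by
    have e1 : |β * γ / (1 + s)| ≤ |β * γ| := by
      rw [abs_div, abs_of_pos (by linarith : 0 < 1 + s)]
      exact div_le_self (by positivity) (by linarith)
    refine (abs_sub _ _).trans ?_
    rw [abs_mul 2, abs_two]
    linarith
  have hbound (s : ℝ) (hs : 0 ≤ s) : √(w s ^ 2 + v s ^ 2) ≤ K₂ * forcedSize a b f Y I s := by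
    have e1 := sqrt_energy_le (L := fun s => w s ^ 2 + v s ^ 2) (n := fun s => |a * (d s * f s)|)
      (L' := _) hc0 (by fun_prop) (fun s => by positivity)
      (fun s hs => ((hwd s hs).pow 2).add ((hvd s hs).pow 2))
      (by fun_prop) (fun s => abs_nonneg _)
      (fun s hs => by
        have := energy_deriv_le (w := w s) (v := v s) (n := a * (d s * f s)) (β := β)
          (τ := 1 + s) ha (hp hs) hq (hr hs)
        simpa using this) hs
    have e2 : ∫ r in (0:ℝ)..s, |a * (d r * f r)| = a * ∫ r in (0:ℝ)..s, d r * |f r| := by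
      rw [← intervalIntegral.integral_const_mul]
      congr 1 with r
      rw [abs_mul, abs_mul, abs_of_pos ha, abs_of_pos (hdpos r)]
    have hd0 : d 0 = 1 := by simp [hd, damp]
    have e3 : √(w 0 ^ 2 + v 0 ^ 2) ≤ |w 0| + |v 0| := by
      rw [Real.sqrt_le_left (by positivity)]
      nlinarith [sq_abs (w 0), sq_abs (v 0), abs_nonneg (w 0), abs_nonneg (v 0),
        mul_nonneg (abs_nonneg (w 0)) (abs_nonneg (v 0))]
    have e4 : |v 0| ≤ (a + 1) * (|Y 0| + |I 0|) := by
      simp only [hv, hd0, one_mul]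
      have := abs_sub (a * I 0) (Y 0)
      rw [abs_mul, abs_of_pos ha] at this
      nlinarith [abs_nonneg (Y 0), abs_nonneg (I 0)]
    have e5 : |w 0| ≤ |Y 0| + |γ| * |v 0| := by
      rw [hw', hd0]
      simpa [abs_mul] using abs_add_le (Y 0) (γ * v 0)
    have hint : 0 ≤ ∫ r in (0:ℝ)..s, d r * |f r| :=
      intervalIntegral.integral_nonneg hs fun r _ => mul_nonneg (hdpos r).le (abs_nonneg _)
    have e6 : √(w 0 ^ 2 + v 0 ^ 2) ≤ (1 + (|γ| + 1) * (a + 1)) * (|Y 0| + |I 0|) := by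
      have := mul_le_mul_of_nonneg_left e4 (by positivity : 0 ≤ |γ| + 1)
      have := abs_nonneg (I 0)
      linarith
    rw [e2] at e1
    refine e1.trans ?_
    rw [hK₂, forcedSize, mul_assoc]
    gcongr
    have h1 : 0 ≤ (1 + (|γ| + 1) * (a + 1)) * ∫ r in (0:ℝ)..s, d r * |f r| := by positivity
    have h2 : 0 ≤ a * (|Y 0| + |I 0|) := by positivity
    linarith
  have hwb (s : ℝ) (hs : 0 ≤ s) : |w s| ≤ K₂ * forcedSize a b f Y I s :=
    (Real.abs_le_sqrt (by nlinarith)).trans (hbound s hs)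
  have hvb (s : ℝ) (hs : 0 ≤ s) : |v s| ≤ K₂ * forcedSize a b f Y I s :=
    (Real.abs_le_sqrt (by nlinarith)).trans (hbound s hs)
  have hS : 0 ≤ K₂ * forcedSize a b f Y I t := (abs_nonneg _).trans (hwb t ht)
  refine ⟨?_, ?_, fun ht' => ⟨_, ?_, hwd t ht'⟩⟩
  · have e1 : d t * |Y t| = |w t - γ / (1 + |t|) * v t| := by
      rw [hw', add_sub_cancel_right, abs_mul, abs_of_pos (hdpos t)]
    have e2 : |γ / (1 + |t|) * v t| ≤ |γ| * |v t| := by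
      rw [abs_mul, abs_div]
      gcongr
      exact div_le_self (by positivity) (by rw [abs_of_pos (by positivity)]; simp)
    have e3 : |γ| * |v t| ≤ |γ| * (K₂ * forcedSize a b f Y I t) := by gcongr; exact hvb t ht
    rw [e1]
    refine (abs_sub _ _).trans ?_
    have := hwb t ht
    nlinarith [mul_nonneg hP0 hS, mul_nonneg hQ0 hS]
  · have e1 : d t * |a * I t - Y t| = |v t| := by
      rw [hv, abs_mul, abs_of_pos (hdpos t)]
    rw [e1]
    have := hvb t ht
    nlinarith [mul_nonneg hP0 hS, mul_nonneg hQ0 hS, mul_nonneg (abs_nonneg γ) hS]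
  · refine (abs_add_le _ _).trans ?_
    rw [abs_mul _ (v t), abs_mul _ (w t)]
    have e1 : |-(γ + 2 * β * γ) + β * γ ^ 2 / (1 + t)| * |v t|
        ≤ P * (K₂ * forcedSize a b f Y I t) :=
      mul_le_mul (hp ht') (hvb t ht) (abs_nonneg _) hP0
    have e2 : |-(β * γ)| * |w t| ≤ Q * (K₂ * forcedSize a b f Y I t) :=
      mul_le_mul hq (hwb t ht) (abs_nonneg _) hQ0
    nlinarith [mul_nonneg (abs_nonneg γ) hS]

theorem forcedSize_le {a b : ℝ} {f Y I : ℝ → ℝ}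
    (hf : IntegrableOn (fun s => damp a (b / a) s * |f s|) (Ioi 0)) {t : ℝ} (ht : 0 ≤ t) :
    forcedSize a b f Y I t
      ≤ |Y 0| + |I 0| + ∫ s in Ioi (0:ℝ), damp a (b / a) s * |f s| := by
  unfold forcedSize
  gcongr
  rw [intervalIntegral.integral_of_le ht]
  refine setIntegral_mono_set hf ?_ Ioc_subset_Ioi_self.eventuallyLE
  exact Eventually.of_forall fun s => mul_nonneg (damp_pos _ _ _).le (abs_nonneg _)

theorem growMode_sub_tendsto {a b : ℝ} (ha : 0 < a) {f Y I : ℝ → ℝ} (h : IsForcedSol a b f Y I)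
    (hf : IntegrableOn (fun s => damp a (b / a) s * |f s|) (Ioi 0)) :
    Tendsto (fun t => growMode a b Y I t - damp a (b / a) t * Y t) atTop (nhds 0) := by
  obtain ⟨K, hK, hE⟩ := forced_estimates b ha
  set S := |Y 0| + |I 0| + ∫ s in Ioi (0:ℝ), damp a (b / a) s * |f s|
  have h1 : Tendsto (fun t : ℝ => |b / a / a| * (K * S) * (1 + t)⁻¹) atTop (nhds 0) := by
    have : Tendsto (fun t : ℝ => (1 + t)⁻¹) atTop (nhds 0) :=
      tendsto_inv_atTop_zero.comp (tendsto_atTop_add_const_left _ _ tendsto_id)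
    simpa using this.const_mul (|b / a / a| * (K * S))
  refine squeeze_zero_norm' ?_ h1
  filter_upwards [eventually_ge_atTop 0] with t ht
  have h2 := (hE f Y I h t ht).2.1
  have h3 := mul_le_mul_of_nonneg_left (forcedSize_le (Y := Y) (I := I) hf ht) hK.le
  rw [growMode, add_sub_cancel_left, norm_mul, norm_mul, Real.norm_eq_abs, Real.norm_eq_abs,
    Real.norm_eq_abs, abs_of_pos (damp_pos _ _ _), abs_div, abs_of_nonneg ht,
    abs_of_pos (by linarith : 0 < 1 + t), div_eq_mul_inv, mul_right_comm]
  exact mul_le_mul_of_nonneg_right (mul_le_mul_of_nonneg_left (h2.trans h3) (abs_nonneg _))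
    (inv_nonneg.2 (by linarith))

theorem exists_tendsto_damp_mul {a b : ℝ} (ha : 0 < a) {f Y I : ℝ → ℝ}
    (h : IsForcedSol a b f Y I)
    (hf : IntegrableOn (fun s => damp a (b / a) s * |f s|) (Ioi 0)) :
    ∃ l, Tendsto (fun t => damp a (b / a) t * Y t) atTop (nhds l) := by
  obtain ⟨K, hK, hE⟩ := forced_estimates b ha
  set S := |Y 0| + |I 0| + ∫ s in Ioi (0:ℝ), damp a (b / a) s * |f s|
  have hint : IntegrableOn (deriv (growMode a b Y I)) (Ioi 0) := by
    have h1 : IntegrableOn (fun s => a * (damp a (b / a) s * |f s|) + K * S * (1 + s ^ 2)⁻¹)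
        (Ioi 0) := (hf.const_mul a).add (integrable_inv_one_add_sq.integrableOn.const_mul _)
    refine h1.mono' (measurable_deriv _).aestronglyMeasurable ?_
    filter_upwards [ae_restrict_mem measurableSet_Ioi] with t ht
    have ht : 0 < t := ht
    obtain ⟨ρ, hρ, hd⟩ := (hE f Y I h t ht.le).2.2 ht
    rw [hd.deriv]
    refine (norm_add_le _ _).trans (add_le_add ?_ ?_)
    · rw [norm_mul, norm_mul, Real.norm_of_nonneg ha.le, Real.norm_of_nonneg (damp_pos _ _ _).le,
        Real.norm_eq_abs]
    · rw [norm_div, Real.norm_eq_abs, Real.norm_of_nonneg (by positivity), div_eq_mul_inv]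
      have h3 := mul_le_mul_of_nonneg_left (forcedSize_le (Y := Y) (I := I) hf ht.le) hK.le
      refine mul_le_mul (hρ.trans h3) ?_ (by positivity) ((abs_nonneg ρ).trans (hρ.trans h3))
      gcongr
      nlinarith
  have h1 := tendsto_limUnder_of_hasDerivAt_of_integrableOn_Ioi (f := growMode a b Y I)
    (fun t ht => by
      obtain ⟨ρ, -, hd⟩ := (hE f Y I h t (le_of_lt ht)).2.2 ht
      exact hd.differentiableAt.hasDerivAt) hint
  refine ⟨_, (h1.sub (growMode_sub_tendsto ha h hf)).congr fun t => ?_⟩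
  ring

theorem forced_eq_zero {a b : ℝ} (ha : 0 < a) {Y I : ℝ → ℝ}
    (h : IsForcedSol a b (fun _ => 0) Y I) (hY : Y 0 = 0) (hI : I 0 = 0) {t : ℝ} (ht : 0 ≤ t) :
    Y t = 0 := by
  obtain ⟨K, hK, hE⟩ := forced_estimates b ha
  have h1 := (hE _ Y I h t ht).1
  simp only [forcedSize, hY, hI, abs_zero, mul_zero, intervalIntegral.integral_zero,
    add_zero] at h1
  have := damp_pos a (b / a) t
  exact abs_eq_zero.1 (le_antisymm (nonpos_of_mul_nonpos_right h1 this) (abs_nonneg _))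

theorem continuous_growMode {a b : ℝ} {f Y I : ℝ → ℝ} (h : IsForcedSol a b f Y I) :
    Continuous (growMode a b Y I) := by
  have h1 := h.cY
  have h2 := h.cI
  have h3 := continuous_damp a (b / a)
  have h4 : ∀ s : ℝ, 1 + |s| ≠ 0 := fun s => by positivity
  unfold growMode
  fun_prop (disch := exact h4 _)

theorem not_tendsto_zero_of_late_forcing {a : ℝ} (b : ℝ) (ha : 0 < a) : ∃ T : ℝ, 0 < T ∧
    ∀ f Y I : ℝ → ℝ, IsForcedSol a b f Y I → Y 0 = 0 → I 0 = 0 → (∀ t, 0 ≤ f t) →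
      (∀ t, 0 ≤ t → t ≤ T → f t = 0) →
      IntegrableOn (fun s => damp a (b / a) s * |f s|) (Ioi 0) →
      (∃ t, 0 < t ∧ 0 < f t) →
      ¬ Tendsto (fun t => damp a (b / a) t * Y t) atTop (nhds 0) := by
  obtain ⟨K, hK, hE⟩ := forced_estimates b ha
  refine ⟨K / a, by positivity, fun f Y I h hY hI hf0 hfT hf ⟨t₁, ht₁, hft₁⟩ hlim => ?_⟩
  set T := K / a with hT
  have hT0 : 0 < T := by positivity
  have hdc := continuous_damp a (b / a)
  have hfc := h.cf
  have hdp := damp_pos a (b / a)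
  set A : ℝ → ℝ := fun t => ∫ s in (0:ℝ)..t, damp a (b / a) s * f s with hA
  simp only [abs_of_nonneg (hf0 _)] at hf
  set A' := ∫ s in Ioi (0:ℝ), damp a (b / a) s * f s with hA'
  have hAlim : Tendsto A atTop (nhds A') := intervalIntegral_tendsto_integral_Ioi 0 hf tendsto_id
  have hsize (t : ℝ) : forcedSize a b f Y I t = A t := by
    simp [forcedSize, hY, hI, hA, abs_of_nonneg (hf0 _)]
  have hAle (t : ℝ) (ht : 0 ≤ t) : A t ≤ A' := by
    rw [← hsize]
    refine (forcedSize_le (by simpa only [abs_of_nonneg (hf0 _)] using hf) ht).trans ?_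
    simp [hY, hI, abs_of_nonneg (hf0 _), hA']
  have hA'pos : 0 < A' := by
    refine lt_of_lt_of_le ?_ (hAle (t₁ + 1) (by linarith))
    refine intervalIntegral.integral_pos (by linarith) (by fun_prop)
      (fun s _ => mul_nonneg (hdp s).le (hf0 s)) ⟨t₁, ⟨ht₁.le, by linarith⟩, ?_⟩
    exact mul_pos (hdp _) hft₁
  have hAT : A T = 0 := by
    simp only [hA]
    rw [intervalIntegral.integral_congr (g := fun _ => 0), intervalIntegral.integral_zero]
    intro s hs
    rw [uIcc_of_le hT0.le] at hs
    simp [hfT s hs.1 hs.2]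
  have hAd (t : ℝ) : HasDerivAt A (damp a (b / a) t * f t) t :=
    (hdc.mul hfc).integral_hasStrictDerivAt 0 t |>.hasDerivAt
  have hwT : growMode a b Y I T = 0 := by
    have h1 := (hE f Y I h T hT0.le).1
    have h2 := (hE f Y I h T hT0.le).2.1
    rw [hsize, hAT, mul_zero] at h1 h2
    have h3 := abs_eq_zero.1 (le_antisymm (nonpos_of_mul_nonpos_right h1 (hdp T)) (abs_nonneg _))
    have h4 := abs_eq_zero.1 (le_antisymm (nonpos_of_mul_nonpos_right h2 (hdp T)) (abs_nonneg _))
    simp [growMode, h3]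
    right; right
    simpa [h3] using h4
  have hcont : ∀ s : ℝ, 1 + |s| ≠ 0 := fun s => by positivity
  have hmono : MonotoneOn (fun t => growMode a b Y I t - a * A t - K * A' * (1 + t)⁻¹)
      (Ici T) := by
    have hpos {t : ℝ} (ht : T ≤ t) : 1 + t ≠ 0 := by linarith
    apply monotoneOn_of_deriv_nonneg (convex_Ici T)
    · refine (((continuous_growMode h).sub (continuous_const.mul
        (continuous_iff_continuousAt.2 fun t => (hAd t).continuousAt))).continuousOn).sub ?_
      refine continuousOn_const.mul (ContinuousOn.inv₀ (by fun_prop) fun t ht => hpos ht)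
    all_goals
      intro t ht
      rw [interior_Ici] at ht
      have ht0 : 0 < t := hT0.trans ht
      obtain ⟨ρ, hρ, hd⟩ := (hE f Y I h t ht0.le).2.2 ht0
      have hd1 : HasDerivAt (fun t => growMode a b Y I t - a * A t - K * A' * (1 + t)⁻¹)
          (a * (damp a (b / a) t * f t) + ρ / (1 + t) ^ 2 - a * (damp a (b / a) t * f t)
            - K * A' * (-1 / (1 + t) ^ 2)) t :=
        (hd.sub ((hAd t).const_mul a)).sub
          ((((hasDerivAt_id t).const_add 1).inv (hpos (le_of_lt ht))).const_mul (K * A'))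
    · exact hd1.differentiableAt.differentiableWithinAt
    · rw [hd1.deriv]
      rw [hsize] at hρ
      have h1 : -(K * A') ≤ ρ := by
        have := mul_le_mul_of_nonneg_left (hAle t ht0.le) hK.le
        linarith [neg_abs_le ρ]
      have h2 : 0 ≤ (ρ + K * A') / (1 + t) ^ 2 := div_nonneg (by linarith) (by positivity)
      calc (0:ℝ) ≤ (ρ + K * A') / (1 + t) ^ 2 := h2
        _ = _ := by ring
  have hw : Tendsto (growMode a b Y I) atTop (nhds 0) := by
    have := (growMode_sub_tendsto ha h
      (by simpa only [abs_of_nonneg (hf0 _)] using hf)).add hlim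
    simpa using this
  have hle : a * A' - K * A' * (1 + T)⁻¹ ≤ 0 := by
    refine le_of_tendsto_of_tendsto ((hAlim.const_mul a).sub_const _) hw ?_
    filter_upwards [eventually_ge_atTop T] with t ht
    have h1 := hmono (mem_Ici.2 le_rfl) (mem_Ici.2 ht) ht
    simp only [hwT, hAT] at h1
    have h2 : 0 ≤ K * A' * (1 + t)⁻¹ := by
      have : 0 < 1 + t := by linarith
      positivity
    linarith
  have h3 : K * (1 + T)⁻¹ < a := by
    rw [← div_eq_mul_inv, div_lt_iff₀ (by positivity), hT, mul_add, mul_div_cancel₀ _ ha.ne']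
    linarith
  nlinarith [mul_lt_mul_of_pos_right h3 hA'pos]

open scoped NNReal in
theorem IsStdBrownian.isPreBrownianReal {Ω : Type*} {mΩ : MeasurableSpace Ω} {P : Measure Ω}
    [IsProbabilityMeasure P] {F : MeasureTheory.Filtration ℝ mΩ} {B : ℝ → Ω → ℝ}
    (hB : IsStdBrownian P F B) : IsPreBrownianReal (fun (t : ℝ≥0) ω => B t ω) P := by
  obtain ⟨hA, h0, -, hL, hI⟩ := hB
  have hm (t : ℝ) : Measurable (B t) := (hA t).mono (F.le t) le_rfl
  refine HasIndepIncrements.isPreBrownianReal_of_hasLaw (fun t => ⟨(hm t).aemeasurable, ?_⟩)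
    (.of_nat fun t ht _ => ?_)
  · simpa [h0] using hL 0 t le_rfl t.2
  rw [iIndepFun_iff_measure_inter_preimage_eq_mul]
  intro S sets hsets
  induction S using Finset.induction_on_max with
  | empty => simp
  | insert n S hn ih =>
    have hnS : n ∉ S := fun h => lt_irrefl _ (hn n h)
    rw [Finset.prod_insert hnS, Finset.set_biInter_insert,
      ← ih fun i hi => hsets i (Finset.mem_insert_of_mem hi)]
    refine (Indep_iff _ _ _).1 (hI (t n) (t (n + 1)) (t n).2 (ht n.le_succ)) _ _
      ⟨sets n, hsets n (Finset.mem_insert_self _ _), rfl⟩ ?_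
    refine Finset.measurableSet_biInter _ fun i hi => ?_
    have hle (j : ℕ) (hj : j ≤ n) : Measurable[F (t n)] (B (t j)) :=
      (hA (t j)).mono (F.mono (ht hj)) le_rfl
    exact ((hle (i + 1) (hn i hi)).sub (hle i (hn i hi).le))
      (hsets i (Finset.mem_insert_of_mem hi))

open scoped NNReal in
theorem ae_tendsto_inv_mul {Ω : Type*} {mΩ : MeasurableSpace Ω}
    {P : Measure Ω} {B : ℝ≥0 → Ω → ℝ} (hB : IsPreBrownianReal B P)
    (hm : ∀ t, Measurable (B t)) (hc : ∀ ω, Continuous fun t => B t ω) (h0 : ∀ ω, B 0 ω = 0) :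
    ∀ᵐ ω ∂P, Tendsto (fun t : ℝ≥0 => (t : ℝ)⁻¹ * B t ω) atTop (nhds 0) := by
  have : IsProbabilityMeasure P := hB.isGaussianProcess.isProbabilityMeasure
  set W : ℝ≥0 → Ω → ℝ := fun t ω => t * B (1 / t) ω with hW
  have hWB : IsPreBrownianReal W P := hB.inv
  let l : Filter ℚ≥0 := comap (fun q : ℚ≥0 => (q : ℝ≥0)) (nhds 0)
  have hmap : P.map (fun ω (q : ℚ≥0) => B q ω) = P.map (fun ω (q : ℚ≥0) => W q ω) := by
    have h1 : Measurable fun ω (q : ℚ≥0) => B q ω := measurable_pi_lambda _ fun q => hm _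
    have h2 : Measurable fun ω (q : ℚ≥0) => W q ω :=
      measurable_pi_lambda _ fun q => (hm _).const_mul _
    rw [map_eq_iff_forall_finset_map_restrict_eq h1.aemeasurable h2.aemeasurable]
    intro J
    classical
    let J' : Finset ℝ≥0 := J.image fun q : ℚ≥0 => (q : ℝ≥0)
    let r : (J' → ℝ) → (J → ℝ) := fun x q => x ⟨(q : ℚ≥0), Finset.mem_image_of_mem _ q.2⟩
    have hr : Measurable r := measurable_pi_lambda _ fun q => measurable_pi_apply _
    have h3 := congrArg (Measure.map r)
      ((hB.hasLaw J').map_eq.trans (hWB.hasLaw J').map_eq.symm)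
    rwa [AEMeasurable.map_map_of_aemeasurable hr.aemeasurable (hB.hasLaw J').aemeasurable,
      AEMeasurable.map_map_of_aemeasurable hr.aemeasurable (hWB.hasLaw J').aemeasurable] at h3
  have hset : MeasurableSet {x : ℚ≥0 → ℝ | Tendsto x l (nhds 0)} := by
    have := measurableSet_tendsto (l := l) (nhds (0:ℝ)) (f := fun q (x : ℚ≥0 → ℝ) => x q)
      fun q => measurable_pi_apply q
    exact this
  have hBl : ∀ᵐ x ∂(P.map fun ω (q : ℚ≥0) => B q ω), Tendsto x l (nhds 0) := by
    rw [ae_map_iff (by fun_prop) hset]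
    refine Eventually.of_forall fun ω => ?_
    have := (hc ω).tendsto 0
    rw [h0] at this
    exact this.comp tendsto_comap
  rw [hmap, ae_map_iff (measurable_pi_lambda _ fun q => (hm _).const_mul _).aemeasurable hset]
    at hBl
  filter_upwards [hBl] with ω hω
  rw [Metric.tendsto_nhds]
  intro ε hε
  have h1 := (Metric.tendsto_nhds.1 hω) (ε / 2) (half_pos hε)
  obtain ⟨u, hu, hul⟩ := mem_comap.1 h1
  obtain ⟨δ, hδ, hδu⟩ := (nhds_bot_basis (α := ℝ≥0)).mem_iff.1 hu
  have hδ : 0 < δ := hδ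
  have hdense : DenseRange (fun q : ℚ≥0 => (q : ℝ≥0)) :=
    dense_of_exists_between fun s t hst => by
      obtain ⟨q, hq0, hq⟩ := NNReal.lt_iff_exists_rat_btwn s t |>.1 hst
      refine ⟨_, ⟨q.toNNRat, rfl⟩, ?_⟩
      have h2 : ((q.toNNRat : ℝ≥0)) = Real.toNNReal q := by
        rw [← NNReal.coe_inj, Real.coe_toNNReal _ (by exact_mod_cast hq0)]
        conv_rhs => rw [← Rat.coe_toNNRat q hq0]
        norm_cast
      change s < (q.toNNRat : ℝ≥0) ∧ (q.toNNRat : ℝ≥0) < t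
      rwa [h2]
  have hclosed : IsClosed {t : ℝ≥0 | |B t ω| ≤ ε / 2 * t} :=
    isClosed_le (hc ω).abs (by fun_prop)
  have hsub : Ioi (1 / δ) ⊆ {t : ℝ≥0 | |B t ω| ≤ ε / 2 * t} := by
    refine (hdense.open_subset_closure_inter isOpen_Ioi).trans
      (closure_minimal ?_ hclosed)
    rintro _ ⟨hq, q, rfl⟩
    have hq : 1 / δ < (q : ℝ≥0) := hq
    have hq0 : 0 < (q : ℝ≥0) := lt_of_le_of_lt zero_le hq
    have h2 : dist (W ((q⁻¹ : ℚ≥0) : ℝ≥0) ω) 0 < ε / 2 := by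
      refine hul (hδu ?_)
      simp only [mem_Iio, NNRat.cast_inv]
      rwa [inv_lt_comm₀ hq0 hδ, ← one_div]
    simp only [hW, NNRat.cast_inv, one_div, inv_inv, dist_zero_right, norm_mul, NNReal.coe_inv,
      norm_inv, Real.norm_eq_abs, NNReal.abs_eq] at h2
    rw [inv_mul_lt_iff₀ (by exact_mod_cast hq0)] at h2
    rw [mem_ofPred_eq, mul_comm]
    exact h2.le
  filter_upwards [eventually_gt_atTop (1 / δ)] with t ht
  have h2 : |B t ω| ≤ ε / 2 * t := hsub ht
  have ht0 : (0 : ℝ) < t := NNReal.coe_pos.2 (lt_of_le_of_lt zero_le ht)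
  rw [dist_zero_right, norm_mul, norm_inv, Real.norm_of_nonneg ht0.le, inv_mul_lt_iff₀ ht0,
    Real.norm_eq_abs]
  nlinarith

theorem tendsto_div_one_add_rpow (p : ℝ) :
    Tendsto (fun t : ℝ => (t / (1 + t)) ^ p) atTop (nhds 1) := by
  have h1 : Tendsto (fun t : ℝ => 1 - (1 + t)⁻¹) atTop (nhds (1 - 0)) :=
    tendsto_const_nhds.sub
      (tendsto_inv_atTop_zero.comp (tendsto_atTop_add_const_left _ _ tendsto_id))
  have h2 : Tendsto (fun t : ℝ => t / (1 + t)) atTop (nhds 1) := by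
    rw [sub_zero] at h1
    refine h1.congr' ?_
    filter_upwards [eventually_gt_atTop 0] with t ht
    field_simp
    ring
  simpa using h2.rpow_const (p := p) (Or.inl one_ne_zero)

theorem tendsto_rpow_mul_damp {a : ℝ} (ha : 0 < a) (β k : ℝ) :
    Tendsto (fun t => t ^ k * damp a β t) atTop (nhds 0) := by
  have h1 := ((tendsto_div_one_add_rpow k).mul
    ((tendsto_rpow_mul_exp_neg_mul_atTop_nhds_zero (k - β) a ha).comp
      (tendsto_atTop_add_const_left _ (1 : ℝ) tendsto_id))).const_mul (exp a)
  rw [mul_zero, mul_zero] at h1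
  refine h1.congr' ?_
  filter_upwards [eventually_gt_atTop 0] with t ht
  have ht1 : 0 < 1 + t := by linarith
  simp only [Function.comp_apply, id, damp, abs_of_pos ht]
  rw [div_rpow ht.le ht1.le, rpow_sub ht1, rpow_neg ht1.le,
    show -a * (1 + t) = -a + -(a * t) by ring, exp_add, exp_neg a]
  have := (rpow_pos_of_pos ht1 k).ne'
  field_simp

theorem IsStdBrownian.ae_tendsto_damp_mul {Ω : Type*} {mΩ : MeasurableSpace Ω} {P : Measure Ω}
    [IsProbabilityMeasure P] {F : MeasureTheory.Filtration ℝ mΩ} {B : ℝ → Ω → ℝ}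
    (hB : IsStdBrownian P F B) {a : ℝ} (ha : 0 < a) (β : ℝ) :
    ∀ᵐ ω ∂P, Tendsto (fun t => damp a β t * B t ω) atTop (nhds 0) := by
  have h1 := ae_tendsto_inv_mul hB.isPreBrownianReal
    (fun t => (hB.1 t).mono (F.le t) le_rfl)
    (fun ω => (hB.2.2.1 ω).comp NNReal.continuous_coe) hB.2.1
  filter_upwards [h1] with ω hω
  have h2 := (tendsto_rpow_mul_damp ha β 1).mul (hω.comp tendsto_real_toNNReal_atTop)
  rw [mul_zero] at h2
  refine h2.congr' ?_
  filter_upwards [eventually_gt_atTop 0] with t ht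
  simp only [rpow_one, Function.comp_apply, Real.coe_toNNReal _ ht.le]
  field_simp

theorem integrableOn_mul_damp {a : ℝ} (ha : 0 < a) (β : ℝ) :
    IntegrableOn (fun s => s * damp a β s) (Ioi 0) := by
  refine integrable_of_isBigO_exp_neg (b := a / 2) (half_pos ha)
    (continuous_id.mul (continuous_damp a β)).continuousOn ?_
  refine Asymptotics.IsLittleO.isBigO (Asymptotics.isLittleO_of_tendsto
    (fun s hs => absurd hs (exp_pos _).ne') ?_)
  refine (tendsto_rpow_mul_damp (half_pos ha) β 1).congr fun s => ?_
  rw [rpow_one, damp, damp, mul_div_assoc, mul_div_right_comm, ← exp_sub]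
  ring_nf

theorem integrableOn_damp {a : ℝ} (ha : 0 < a) (β : ℝ) :
    IntegrableOn (damp a β) (Ioi 0) := by
  refine integrable_of_isBigO_exp_neg (b := a / 2) (half_pos ha)
    (continuous_damp a β).continuousOn ?_
  refine Asymptotics.IsLittleO.isBigO (Asymptotics.isLittleO_of_tendsto
    (fun s hs => absurd hs (exp_pos _).ne') ?_)
  refine (tendsto_rpow_mul_damp (half_pos ha) β 0).congr fun s => ?_
  rw [rpow_zero, one_mul, damp, damp, mul_div_right_comm, ← exp_sub]
  ring_nf

/-- A random forced solution with deterministic initial data `y`, `i` and a square-integrable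
forcing term of at most linearly growing second moment. -/
structure IsForcedProcess {Ω : Type*} {mΩ : MeasurableSpace Ω} (P : Measure Ω) (a b : ℝ)
    (f Y I : ℝ → Ω → ℝ) (y i : ℝ) : Prop where
  mf : ∀ t, Measurable (f t)
  mY : ∀ t, Measurable (Y t)
  mI : ∀ t, Measurable (I t)
  cf : ∀ ω, Continuous fun t => f t ω
  cY : ∀ ω, Continuous fun t => Y t ω
  cI : ∀ ω, Continuous fun t => I t ω
  Y0 : ∀ ω, Y 0 ω = y
  I0 : ∀ ω, I 0 ω = i
  sol : ∀ᵐ ω ∂P, IsForcedSol a b (fun t => f t ω) (fun t => Y t ω) (fun t => I t ω)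
  memLp : ∀ t, MemLp (f t) 2 P
  sq_le : ∃ c, ∀ t, 0 ≤ t → ∫ ω, f t ω ^ 2 ∂P ≤ c * t

section ForcedProcess

variable {Ω : Type*} {mΩ : MeasurableSpace Ω} {P : Measure Ω}

theorem IsForcedProcess.integrable_prod [SFinite P] {a b y i : ℝ} (ha : 0 < a)
    {f Y I : ℝ → Ω → ℝ}
    (h : IsForcedProcess P a b f Y I y i) (β : ℝ) :
    Integrable (fun p : ℝ × Ω => damp a β p.1 * f p.1 p.2 ^ 2)
      ((volume.restrict (Ioi 0)).prod P) := by
  have hjm : StronglyMeasurable fun p : ℝ × Ω => damp a β p.1 * f p.1 p.2 ^ 2 :=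
    ((continuous_damp a β).measurable.comp measurable_fst).mul
      ((measurable_uncurry_of_continuous_of_measurable (u := f) h.cf h.mf).pow_const 2)
      |>.stronglyMeasurable
  obtain ⟨c, hc⟩ := h.sq_le
  rw [integrable_prod_iff hjm.aestronglyMeasurable]
  refine ⟨Eventually.of_forall fun s =>
    (h.memLp s).integrable_sq.const_mul (damp a β s), ?_⟩
  refine ((integrableOn_mul_damp ha β).const_mul c).mono'
    hjm.norm.integral_prod_right'.aestronglyMeasurable ?_
  filter_upwards [ae_restrict_mem measurableSet_Ioi] with s hs
  have hs : 0 < s := hs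
  have hd := (damp_pos a β s).le
  rw [Real.norm_of_nonneg (integral_nonneg fun _ => norm_nonneg _)]
  simp only [norm_mul, norm_pow, Real.norm_of_nonneg hd, Real.norm_eq_abs, sq_abs]
  rw [integral_const_mul]
  nlinarith [hc s hs.le]

theorem sq_integral_damp_mul_le {a : ℝ} (ha : 0 < a) (β : ℝ) {f : ℝ → ℝ} (hf : Continuous f)
    (hi : IntegrableOn (fun s => damp a β s * f s ^ 2) (Ioi 0)) :
    IntegrableOn (fun s => damp a β s * |f s|) (Ioi 0) ∧
    (∫ s in Ioi (0:ℝ), damp a β s * |f s|) ^ 2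
      ≤ (∫ s in Ioi (0:ℝ), damp a β s) * ∫ s in Ioi (0:ℝ), damp a β s * f s ^ 2 := by
  have hW := integrableOn_damp ha β
  have hdc := continuous_damp a β
  have h1 : IntegrableOn (fun s => damp a β s * |f s|) (Ioi 0) := by
    refine (hW.add hi).mono' (by fun_prop) (Eventually.of_forall fun s => ?_)
    have := damp_pos a β s
    rw [Real.norm_of_nonneg (by positivity), Pi.add_apply]
    nlinarith [sq_abs (f s), sq_nonneg (|f s| - 1)]
  refine ⟨h1, ?_⟩
  set N := ∫ s in Ioi (0:ℝ), damp a β s * |f s|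
  set W := ∫ s in Ioi (0:ℝ), damp a β s
  set V := ∫ s in Ioi (0:ℝ), damp a β s * f s ^ 2
  have hWpos : 0 < W := by
    refine (setIntegral_pos_iff_support_of_nonneg_ae
      (Eventually.of_forall fun s => (damp_pos a β s).le) hW).2 ?_
    rw [Function.support_eq_univ fun s => (damp_pos a β s).ne']
    simp
  have h2 (l : ℝ) : 0 ≤ V - 2 * l * N + l ^ 2 * W := by
    have hsub : IntegrableOn
        (fun s => damp a β s * f s ^ 2 - 2 * l * (damp a β s * |f s|)) (Ioi 0) :=
      hi.sub (h1.const_mul (2 * l))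
    have : V - 2 * l * N + l ^ 2 * W = ∫ s in Ioi (0:ℝ), damp a β s * (|f s| - l) ^ 2 := by
      simp only [N, W, V]
      rw [← integral_const_mul, ← integral_const_mul, ← integral_sub hi (h1.const_mul _),
        ← integral_add hsub (hW.const_mul _)]
      congr 1 with s
      rw [← sq_abs (f s)]
      ring
    rw [this]
    exact integral_nonneg fun s => mul_nonneg (damp_pos _ _ _).le (sq_nonneg _)
  have h3 := h2 (N / W)
  field_simp at h3
  nlinarith

theorem IsForcedProcess.exists_bound [IsProbabilityMeasure P] {a b y i : ℝ} (ha : 0 < a)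
    {f Y I : ℝ → Ω → ℝ} (h : IsForcedProcess P a b f Y I y i) :
    ∃ Z : Ω → ℝ, MemLp Z 2 P ∧ ∀ᵐ ω ∂P,
      IntegrableOn (fun s => damp a (b / a) s * |f s ω|) (Ioi 0) ∧
      ∀ t, 0 ≤ t → damp a (b / a) t * |Y t ω| ≤ Z ω ∧ damp a (b / a) t * |I t ω| ≤ Z ω := by
  obtain ⟨K, hK, hE⟩ := forced_estimates b ha
  have hp := h.integrable_prod ha (b / a)
  set W := ∫ s in Ioi (0:ℝ), damp a (b / a) s
  set V : Ω → ℝ := fun ω => ∫ s in Ioi (0:ℝ), damp a (b / a) s * f s ω ^ 2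
  have hV : Integrable V P := hp.integral_prod_right
  have hV0 (ω : Ω) : 0 ≤ V ω :=
    integral_nonneg fun s => mul_nonneg (damp_pos _ _ _).le (sq_nonneg _)
  have hsV : MemLp (fun ω => √(W * V ω)) 2 P := by
    have hW0 : 0 ≤ W := integral_nonneg fun s => (damp_pos _ _ _).le
    rw [memLp_two_iff_integrable_sq
      (hV.const_mul W).aemeasurable.sqrt.aestronglyMeasurable]
    simp only [Real.sq_sqrt (mul_nonneg hW0 (hV0 _))]
    exact hV.const_mul W
  refine ⟨fun ω => (1 + 2 / a) * K * (|y| + |i| + √(W * V ω)), ?_, ?_⟩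
  · have h1 : MemLp (fun ω => |y| + |i| + √(W * V ω)) 2 P :=
      (memLp_const (|y| + |i|)).add hsV
    exact h1.const_mul ((1 + 2 / a) * K)
  filter_upwards [h.sol, hp.prod_left_ae] with ω hω hωi
  obtain ⟨h1, h2⟩ := sq_integral_damp_mul_le ha (b / a) (h.cf ω) hωi
  refine ⟨h1, fun t ht => ?_⟩
  set S := |y| + |i| + √(W * V ω)
  have hS : forcedSize a b (fun t => f t ω) (fun t => Y t ω) (fun t => I t ω) t ≤ S := by
    refine (forcedSize_le h1 ht).trans ?_
    simp only [h.Y0, h.I0]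
    exact add_le_add_right (Real.le_sqrt_of_sq_le h2) _
  have hS0 : 0 ≤ S := by positivity
  obtain ⟨e1, e2, -⟩ := hE _ _ _ hω t ht
  have e1 := e1.trans (mul_le_mul_of_nonneg_left hS hK.le)
  have e2 := e2.trans (mul_le_mul_of_nonneg_left hS hK.le)
  have hKS : 0 ≤ K * S := by positivity
  have hd := damp_pos a (b / a) t
  constructor
  · have : 0 ≤ 2 / a * (K * S) := by positivity
    nlinarith
  · have h3 : a * |I t ω| ≤ |a * I t ω - Y t ω| + |Y t ω| := by
      rw [← abs_of_pos ha, ← abs_mul, abs_of_pos ha]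
      simpa using abs_add_le (a * I t ω - Y t ω) (Y t ω)
    have h4 : damp a (b / a) t * |I t ω| ≤ 2 / a * (K * S) := by
      rw [div_mul_eq_mul_div, le_div_iff₀ ha]
      nlinarith
    nlinarith

theorem integral_intervalIntegral_mul [SFinite P] {U : ℝ → Ω → ℝ} (hm : ∀ s, Measurable (U s))
    (hc : ∀ ω, Continuous fun s => U s ω) {ξ : Ω → ℝ} (hξ : MemLp ξ 2 P) {w : ℝ → ℝ}
    (hw : Continuous w) {t c : ℝ} (ht : 0 ≤ t)
    (hU : ∀ s ∈ Icc 0 t, MemLp (U s) 2 P ∧ ∫ ω, U s ω ^ 2 ∂P ≤ c) :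
    Integrable (fun ω => (∫ s in (0:ℝ)..t, w s * U s ω) * ξ ω) P ∧
    ∫ ω, (∫ s in (0:ℝ)..t, w s * U s ω) * ξ ω ∂P
      = ∫ s in (0:ℝ)..t, w s * ∫ ω, U s ω * ξ ω ∂P := by
  have hjm : AEStronglyMeasurable (fun p : ℝ × Ω => w p.1 * U p.1 p.2 * ξ p.2)
      ((volume.restrict (Ioc 0 t)).prod P) :=
    ((hw.measurable.comp measurable_fst).mul
      (measurable_uncurry_of_continuous_of_measurable (u := U) hc hm)).aestronglyMeasurable.mul
      hξ.aestronglyMeasurable.comp_snd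
  have hp : Integrable (fun p : ℝ × Ω => w p.1 * U p.1 p.2 * ξ p.2)
      ((volume.restrict (Ioc 0 t)).prod P) := by
    rw [integrable_prod_iff hjm]
    constructor
    · filter_upwards [ae_restrict_mem measurableSet_Ioc] with s hs
      exact ((hU s ⟨hs.1.le, hs.2⟩).1.const_mul (w s)).integrable_mul hξ
    · have hi : IntegrableOn (fun s => |w s| * (c + ∫ ω, ξ ω ^ 2 ∂P)) (Ioc 0 t) :=
        ((hw.abs.mul continuous_const).integrableOn_Icc).mono_set Ioc_subset_Icc_self
      refine hi.mono' hjm.norm.integral_prod_right' ?_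
      filter_upwards [ae_restrict_mem measurableSet_Ioc] with s hs
      obtain ⟨h1, h2⟩ := hU s ⟨hs.1.le, hs.2⟩
      rw [Real.norm_of_nonneg (integral_nonneg fun _ => norm_nonneg _)]
      simp only [norm_mul, Real.norm_eq_abs, mul_assoc]
      rw [integral_const_mul]
      refine mul_le_mul_of_nonneg_left ?_ (abs_nonneg _)
      refine le_trans ?_ (add_le_add_left h2 _)
      rw [← integral_add h1.integrable_sq hξ.integrable_sq]
      refine integral_mono (h1.abs.integrable_mul hξ.abs) (h1.integrable_sq.add hξ.integrable_sq)
        fun ω => ?_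
      simp only [← sq_abs (U s ω), ← sq_abs (ξ ω)]
      nlinarith [sq_nonneg (|U s ω| - |ξ ω|), sq_nonneg (|U s ω| + |ξ ω|)]
  have heq (ω : Ω) : (∫ s in (0:ℝ)..t, w s * U s ω) * ξ ω
      = ∫ s in Ioc 0 t, w s * U s ω * ξ ω := by
    rw [intervalIntegral.integral_of_le ht, integral_mul_const]
  simp only [heq]
  refine ⟨hp.integral_prod_right, ?_⟩
  rw [← integral_integral_swap hp, intervalIntegral.integral_of_le ht]
  simp only [mul_assoc, integral_const_mul]

theorem continuous_integral_mul {U : ℝ → Ω → ℝ} {Z ξ : Ω → ℝ} {a β : ℝ}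
    (hm : ∀ t, Measurable (U t)) (hc : ∀ ω, Continuous fun t => U t ω) (hZ : MemLp Z 2 P)
    (hξ : MemLp ξ 2 P) (hb : ∀ᵐ ω ∂P, ∀ t, 0 ≤ t → damp a β t * |U t ω| ≤ Z ω) :
    Continuous fun t => ∫ ω, U (max t 0) ω * ξ ω ∂P := by
  have h1 : Continuous fun t => ∫ ω, damp a β (max t 0) * U (max t 0) ω * ξ ω ∂P := by
    refine continuous_of_dominated (bound := fun ω => Z ω * |ξ ω|)
      (fun t => ((hm _).const_mul _).aestronglyMeasurable.mul hξ.aestronglyMeasurable)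
      (fun t => ?_) (hZ.integrable_mul hξ.abs) (Eventually.of_forall fun ω => ?_)
    · filter_upwards [hb] with ω hω
      rw [norm_mul, norm_mul, Real.norm_of_nonneg (damp_pos _ _ _).le, Real.norm_eq_abs,
        Real.norm_eq_abs]
      exact mul_le_mul_of_nonneg_right (hω _ (le_max_right _ _)) (abs_nonneg _)
    · have h2 : Continuous fun t : ℝ => max t 0 := by fun_prop
      exact (((continuous_damp a β).comp h2).mul ((hc ω).comp h2)).mul continuous_const
  have h2 : Continuous fun t => (damp a β (max t 0))⁻¹ :=
    ((continuous_damp a β).comp (by fun_prop)).inv₀ fun t => (damp_pos _ _ _).ne'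
  refine (h2.mul h1).congr fun t => ?_
  simp only [Pi.mul_apply, mul_assoc, integral_const_mul]
  rw [inv_mul_cancel_left₀ (damp_pos _ _ _).ne']

theorem memLp_of_damp_bound {U Z : Ω → ℝ} {a β t : ℝ} (hm : Measurable U) (hZ : MemLp Z 2 P)
    (hb : ∀ᵐ ω ∂P, damp a β t * |U ω| ≤ Z ω) :
    MemLp U 2 P ∧ ∫ ω, U ω ^ 2 ∂P ≤ ((damp a β t)⁻¹) ^ 2 * ∫ ω, Z ω ^ 2 ∂P := by
  have hb' : ∀ᵐ ω ∂P, |U ω| ≤ (damp a β t)⁻¹ * Z ω := by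
    filter_upwards [hb] with ω hω
    rwa [← div_eq_inv_mul, le_div_iff₀ (damp_pos _ _ _), mul_comm]
  have h1 : MemLp U 2 P := (hZ.const_mul (damp a β t)⁻¹).mono' hm.aestronglyMeasurable hb'
  refine ⟨h1, ?_⟩
  rw [← integral_const_mul]
  refine integral_mono_ae h1.integrable_sq (hZ.integrable_sq.const_mul _) ?_
  filter_upwards [hb'] with ω hω
  simp only [← mul_pow]
  exact sq_le_sq' (by linarith [neg_abs_le (U ω)]) ((le_abs_self _).trans hω)

theorem exists_damp_inv_sq_le (a β : ℝ) (t : ℝ) :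
    ∃ D, ∀ s ∈ Icc 0 t, ((damp a β s)⁻¹) ^ 2 ≤ D := by
  have h1 : Continuous fun s => ((damp a β s)⁻¹) ^ 2 :=
    ((continuous_damp a β).inv₀ fun t => (damp_pos _ _ _).ne').pow 2
  obtain ⟨D, hD⟩ := (isCompact_Icc (a := (0:ℝ)) (b := t)).bddAbove_image h1.continuousOn
  exact ⟨D, fun s hs => hD ⟨s, hs, rfl⟩⟩

theorem IsForcedProcess.exists_limit [IsProbabilityMeasure P] {a b y i : ℝ} (ha : 0 < a)
    {f Y I : ℝ → Ω → ℝ} (h : IsForcedProcess P a b f Y I y i) :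
    ∃ C : Ω → ℝ, Measurable C ∧
      ∀ᵐ ω ∂P, Tendsto (fun t => damp a (b / a) t * Y t ω) atTop (nhds (C ω)) := by
  obtain ⟨Z, -, hb⟩ := h.exists_bound ha
  have h1 : ∀ᵐ ω ∂P, ∃ l, Tendsto (fun t => damp a (b / a) t * Y t ω) atTop (nhds l) := by
    filter_upwards [hb, h.sol] with ω hω hs
    exact exists_tendsto_damp_mul ha hs hω.1
  obtain ⟨C, hC, hlim⟩ := measurable_limit_of_tendsto_metrizable_ae (L := atTop)
    (f := fun (n : ℕ) ω => damp a (b / a) n * Y n ω)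
    (fun n => ((h.mY n).const_mul _).aemeasurable) (by
      filter_upwards [h1] with ω ⟨l, hl⟩
      exact ⟨l, hl.comp tendsto_natCast_atTop_atTop⟩)
  refine ⟨C, hC, ?_⟩
  filter_upwards [h1, hlim] with ω ⟨l, hl⟩ hω
  rwa [tendsto_nhds_unique hω (hl.comp tendsto_natCast_atTop_atTop)]

theorem IsForcedSol.eq_integral {a b : ℝ} {f Y I : ℝ → ℝ} (h : IsForcedSol a b f Y I) {t : ℝ}
    (ht : 0 ≤ t) :
    Y t = Y 0 + ((∫ s in (0:ℝ)..t, a * Y s) + (∫ s in (0:ℝ)..t, a * f s)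
        + ∫ s in (0:ℝ)..t, b / (1 + |s|) * I s) ∧
      I t = I 0 + ((∫ s in (0:ℝ)..t, 1 * Y s) + ∫ s in (0:ℝ)..t, 1 * f s) := by
  have hw : Continuous fun s : ℝ => b / (1 + |s|) := by
    have : ∀ s : ℝ, 1 + |s| ≠ 0 := fun s => by positivity
    fun_prop (disch := exact this _)
  have c1 : Continuous fun s => a * Y s := h.cY.const_mul a
  have c2 : Continuous fun s => a * f s := h.cf.const_mul a
  have c3 : Continuous fun s => b / (1 + |s|) * I s := hw.mul h.cI
  have d1 : Continuous fun s => 1 * Y s := h.cY.const_mul 1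
  have d2 : Continuous fun s => 1 * f s := h.cf.const_mul 1
  have c12 : Continuous fun s => a * Y s + a * f s := c1.add c2
  have c123 : Continuous fun s => a * Y s + a * f s + b / (1 + |s|) * I s := c12.add c3
  have d12 : Continuous fun s => 1 * Y s + 1 * f s := d1.add d2
  rw [← intervalIntegral.integral_add (c1.intervalIntegrable _ _) (c2.intervalIntegrable _ _),
    ← intervalIntegral.integral_add (c12.intervalIntegrable _ _)
      (c3.intervalIntegrable _ _),
    ← intervalIntegral.integral_add (d1.intervalIntegrable _ _) (d2.intervalIntegrable _ _)]
  constructor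
  · rw [intervalIntegral.integral_eq_sub_of_hasDerivAt_of_le ht h.cY.continuousOn
      (fun s hs => by simpa [abs_of_pos hs.1] using h.hY s hs.1)
      (c123.intervalIntegrable _ _)]
    ring
  · rw [intervalIntegral.integral_eq_sub_of_hasDerivAt_of_le ht h.cI.continuousOn
      (fun s hs => by simpa using h.hI s hs.1) (d12.intervalIntegrable _ _)]
    ring

theorem IsForcedProcess.exists_isForcedSol_integral [IsProbabilityMeasure P] {a b y i : ℝ}
    (ha : 0 < a) {f Y I : ℝ → Ω → ℝ} (h : IsForcedProcess P a b f Y I y i) {ξ : Ω → ℝ}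
    (hξ : MemLp ξ 2 P) (hξ0 : ∫ ω, ξ ω ∂P = 0) {fu : ℝ → ℝ} (hfu : Continuous fu)
    (hf : ∀ t, 0 ≤ t → ∫ ω, f t ω * ξ ω ∂P = fu t) :
    ∃ Iu : ℝ → ℝ, IsForcedSol a b fu (fun t => ∫ ω, Y (max t 0) ω * ξ ω ∂P) Iu ∧ Iu 0 = 0 := by
  obtain ⟨Z, hZ, hb⟩ := h.exists_bound ha
  set Yu : ℝ → ℝ := fun t => ∫ ω, Y (max t 0) ω * ξ ω ∂P
  set Iu : ℝ → ℝ := fun t => ∫ ω, I (max t 0) ω * ξ ω ∂P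
  have hbY : ∀ᵐ ω ∂P, ∀ t, 0 ≤ t → damp a (b / a) t * |Y t ω| ≤ Z ω :=
    hb.mono fun ω hω t ht => (hω.2 t ht).1
  have hbI : ∀ᵐ ω ∂P, ∀ t, 0 ≤ t → damp a (b / a) t * |I t ω| ≤ Z ω :=
    hb.mono fun ω hω t ht => (hω.2 t ht).2
  have hcY : Continuous Yu := continuous_integral_mul h.mY h.cY hZ hξ hbY
  have hcI : Continuous Iu := continuous_integral_mul h.mI h.cI hZ hξ hbI
  have hYu {t : ℝ} (ht : 0 ≤ t) : Yu t = ∫ ω, Y t ω * ξ ω ∂P := by simp only [Yu, max_eq_left ht]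
  have hIu {t : ℝ} (ht : 0 ≤ t) : Iu t = ∫ ω, I t ω * ξ ω ∂P := by simp only [Iu, max_eq_left ht]
  have swap {U : ℝ → Ω → ℝ} {Uu : ℝ → ℝ} (hm : ∀ s, Measurable (U s))
      (hc : ∀ ω, Continuous fun s => U s ω)
      (hUu : ∀ s, 0 ≤ s → Uu s = ∫ ω, U s ω * ξ ω ∂P) {w : ℝ → ℝ} (hw : Continuous w) {t : ℝ}
      (ht : 0 ≤ t) (hU : ∃ c, ∀ s ∈ Icc 0 t, MemLp (U s) 2 P ∧ ∫ ω, U s ω ^ 2 ∂P ≤ c) :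
      Integrable (fun ω => (∫ s in (0:ℝ)..t, w s * U s ω) * ξ ω) P ∧
        ∫ ω, (∫ s in (0:ℝ)..t, w s * U s ω) * ξ ω ∂P = ∫ s in (0:ℝ)..t, w s * Uu s := by
    obtain ⟨c, hU⟩ := hU
    obtain ⟨h1, h2⟩ := integral_intervalIntegral_mul hm hc hξ hw ht hU
    refine ⟨h1, h2.trans (intervalIntegral.integral_congr fun s hs => ?_)⟩
    rw [uIcc_of_le ht] at hs
    simp only [hUu s hs.1]
  have bound {U : ℝ → Ω → ℝ} (hm : ∀ s, Measurable (U s))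
      (hbU : ∀ᵐ ω ∂P, ∀ t, 0 ≤ t → damp a (b / a) t * |U t ω| ≤ Z ω) (t : ℝ) :
      ∃ c, ∀ s ∈ Icc 0 t, MemLp (U s) 2 P ∧ ∫ ω, U s ω ^ 2 ∂P ≤ c := by
    obtain ⟨D, hD⟩ := exists_damp_inv_sq_le a (b / a) t
    refine ⟨D * ∫ ω, Z ω ^ 2 ∂P, fun s hs => ?_⟩
    obtain ⟨h1, h2⟩ := memLp_of_damp_bound (hm s) hZ (hbU.mono fun ω hω => hω s hs.1)
    exact ⟨h1, h2.trans (mul_le_mul_of_nonneg_right (hD s hs)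
      (integral_nonneg fun _ => sq_nonneg _))⟩
  have boundf {t : ℝ} : ∃ c, ∀ s ∈ Icc 0 t, MemLp (f s) 2 P ∧ ∫ ω, f s ω ^ 2 ∂P ≤ c := by
    obtain ⟨c, hc⟩ := h.sq_le
    refine ⟨|c| * t, fun s hs => ⟨h.memLp s, (hc s hs.1).trans ?_⟩⟩
    exact mul_le_mul (le_abs_self c) hs.2 hs.1 (abs_nonneg c)
  have hw : Continuous fun s : ℝ => b / (1 + |s|) := by
    have : ∀ s : ℝ, 1 + |s| ≠ 0 := fun s => by positivity
    fun_prop (disch := exact this _)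
  have hξi : Integrable ξ P := hξ.integrable one_le_two
  have sfu (w : ℝ → ℝ) (hw : Continuous w) {t : ℝ} (ht : 0 ≤ t) :=
    swap h.mf h.cf (fun s hs => (hf s hs).symm) hw ht boundf
  have sY (w : ℝ → ℝ) (hw : Continuous w) {t : ℝ} (ht : 0 ≤ t) :=
    swap h.mY h.cY (fun s hs => hYu hs) hw ht (bound h.mY hbY t)
  have sI (w : ℝ → ℝ) (hw : Continuous w) {t : ℝ} (ht : 0 ≤ t) :=
    swap h.mI h.cI (fun s hs => hIu hs) hw ht (bound h.mI hbI t)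
  have hYeq {t : ℝ} (ht : 0 ≤ t) :
      Yu t = ∫ s in (0:ℝ)..t, (a * Yu s + a * fu s + b / (1 + |s|) * Iu s) := by
    obtain ⟨i1, e1⟩ := sY (fun _ => a) continuous_const ht
    obtain ⟨i2, e2⟩ := sfu (fun _ => a) continuous_const ht
    obtain ⟨i3, e3⟩ := sI _ hw ht
    have c1 : Continuous fun s => a * Yu s := hcY.const_mul a
    have c2 : Continuous fun s => a * fu s := hfu.const_mul a
    have c3 : Continuous fun s => b / (1 + |s|) * Iu s := hw.mul hcI
    have c12 : Continuous fun s => a * Yu s + a * fu s := c1.add c2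
    rw [intervalIntegral.integral_add (c12.intervalIntegrable _ _) (c3.intervalIntegrable _ _),
      intervalIntegral.integral_add (c1.intervalIntegrable _ _) (c2.intervalIntegrable _ _),
      ← e1, ← e2, ← e3, hYu ht]
    have key : (fun ω => Y t ω * ξ ω) =ᵐ[P] ((fun ω => y * ξ ω) +
        (((fun ω => (∫ s in (0:ℝ)..t, a * Y s ω) * ξ ω)
          + fun ω => (∫ s in (0:ℝ)..t, a * f s ω) * ξ ω)
          + fun ω => (∫ s in (0:ℝ)..t, b / (1 + |s|) * I s ω) * ξ ω)) := by
      filter_upwards [h.sol] with ω hω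
      simp only [Pi.add_apply, (hω.eq_integral ht).1, h.Y0]
      ring
    rw [integral_congr_ae key, integral_add' (hξi.const_mul y) ((i1.add i2).add i3),
      integral_add' (i1.add i2) i3, integral_add' i1 i2, integral_const_mul, hξ0, mul_zero,
      zero_add]
  have hIeq {t : ℝ} (ht : 0 ≤ t) : Iu t = ∫ s in (0:ℝ)..t, (Yu s + fu s) := by
    obtain ⟨i1, e1⟩ := sY (fun _ => 1) continuous_const ht
    obtain ⟨i2, e2⟩ := sfu (fun _ => 1) continuous_const ht
    simp only [one_mul] at e1 e2 i1 i2
    rw [intervalIntegral.integral_add (hcY.intervalIntegrable _ _) (hfu.intervalIntegrable _ _),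
      ← e1, ← e2, hIu ht]
    have key : (fun ω => I t ω * ξ ω) =ᵐ[P] ((fun ω => i * ξ ω) +
        ((fun ω => (∫ s in (0:ℝ)..t, Y s ω) * ξ ω)
          + fun ω => (∫ s in (0:ℝ)..t, f s ω) * ξ ω)) := by
      filter_upwards [h.sol] with ω hω
      simp only [Pi.add_apply, (hω.eq_integral ht).2, h.I0, one_mul]
      ring
    rw [integral_congr_ae key, integral_add' (hξi.const_mul i) (i1.add i2),
      integral_add' i1 i2, integral_const_mul, hξ0, mul_zero, zero_add]
  refine ⟨Iu, ⟨hfu, hcY, hcI, fun t ht => ?_, fun t ht => ?_⟩, ?_⟩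
  · have hg : Continuous fun s => a * Yu s + a * fu s + b / (1 + |s|) * Iu s := by fun_prop
    have h1 := hg.integral_hasStrictDerivAt 0 t |>.hasDerivAt
    rw [abs_of_pos ht] at h1
    exact h1.congr_of_eventuallyEq ((eventually_ge_nhds ht).mono fun s hs => hYeq hs)
  · have hg : Continuous fun s => Yu s + fu s := by fun_prop
    exact (hg.integral_hasStrictDerivAt 0 t |>.hasDerivAt).congr_of_eventuallyEq
      ((eventually_ge_nhds ht).mono fun s hs => hIeq hs)
  · rw [hIeq le_rfl, intervalIntegral.integral_same]

theorem integral_norm_sub_le_dist [IsProbabilityMeasure P] (x y : Lp ℝ 2 P) :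
    ∫ ω, ‖x ω - y ω‖ ∂P ≤ dist x y := by
  have h1 : ∫ ω, ‖x ω - y ω‖ ∂P = ∫ ω, ‖(x - y) ω‖ ∂P :=
    integral_congr_ae ((Lp.coeFn_sub x y).mono fun ω hω => by
      simp only [hω, Pi.sub_apply])
  rw [h1, dist_eq_norm, Lp.norm_def, integral_norm_eq_lintegral_enorm
    (Lp.aestronglyMeasurable _), ← eLpNorm_one_eq_lintegral_enorm]
  exact ENNReal.toReal_mono (Lp.eLpNorm_ne_top _)
    (eLpNorm_le_eLpNorm_of_exponent_le one_le_two (Lp.aestronglyMeasurable _))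

theorem continuous_integral_Lp_two [IsProbabilityMeasure P] :
    Continuous fun x : Lp ℝ 2 P => ∫ ω, x ω ∂P := by
  have hi (x : Lp ℝ 2 P) : Integrable x P := (Lp.memLp x).integrable one_le_two
  refine LipschitzWith.continuous (K := 1) (LipschitzWith.of_dist_le_mul fun x y => ?_)
  rw [NNReal.coe_one, one_mul, dist_eq_norm, ← integral_sub (hi x) (hi y)]
  exact (norm_integral_le_integral_norm _).trans (integral_norm_sub_le_dist x y)

theorem integral_Lp_sq_eq (x : Lp ℝ 2 P) : ∫ ω, x ω ^ 2 ∂P = ‖x‖ ^ 2 := by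
  rw [← real_inner_self_eq_norm_sq, L2.inner_def]
  simp [sq]

theorem continuous_charFun_Lp_two [IsProbabilityMeasure P] (t : ℝ) :
    Continuous fun x : Lp ℝ 2 P => charFun (P.map x) t := by
  have hm (x : Lp ℝ 2 P) : AEMeasurable x P := (Lp.aestronglyMeasurable x).aemeasurable
  have he (x : Lp ℝ 2 P) :
      charFun (P.map x) t = ∫ ω, Complex.exp (Complex.I * (t * x ω : ℝ)) ∂P := by
    rw [charFun_apply_real, integral_map (hm x) (by fun_prop)]
    refine integral_congr_ae (Eventually.of_forall fun ω => ?_)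
    push_cast
    ring_nf
  have hi (x : Lp ℝ 2 P) :
      Integrable (fun ω => Complex.exp (Complex.I * (t * x ω : ℝ))) P := by
    refine (integrable_const (1 : ℝ)).mono' ?_ (Eventually.of_forall fun ω => ?_)
    · have : Measurable fun r : ℝ => Complex.exp (Complex.I * (t * r : ℝ)) := by fun_prop
      exact (this.comp_aemeasurable (hm x)).aestronglyMeasurable
    · rw [mul_comm, Complex.norm_exp_ofReal_mul_I]
  refine LipschitzWith.continuous (K := ‖t‖₊) (LipschitzWith.of_dist_le_mul fun x y => ?_)
  rw [he, he, dist_eq_norm, ← integral_sub (hi x) (hi y)]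
  have hb : ∫ ω, ‖t‖ * ‖x ω - y ω‖ ∂P ≤ ‖t‖ * dist x y := by
    rw [integral_const_mul]
    exact mul_le_mul_of_nonneg_left (integral_norm_sub_le_dist x y) (norm_nonneg t)
  refine le_trans ?_ hb
  refine norm_integral_le_of_norm_le (((((Lp.memLp x).sub (Lp.memLp y)).integrable
    one_le_two).norm).const_mul _) (Eventually.of_forall fun ω => ?_)
  have h2 : Complex.exp (Complex.I * (t * x ω : ℝ)) - Complex.exp (Complex.I * (t * y ω : ℝ))
      = Complex.exp ((t * y ω : ℝ) * Complex.I)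
        * (Complex.exp (Complex.I * (t * (x ω - y ω) : ℝ)) - 1) := by
    rw [mul_sub, mul_one, ← Complex.exp_add]
    congr 2 <;> push_cast <;> ring
  rw [h2, norm_mul, Complex.norm_exp_ofReal_mul_I, one_mul, ← norm_mul]
  exact Real.norm_exp_I_mul_ofReal_sub_one_le

theorem isClosed_hasGaussianLaw [IsProbabilityMeasure P] :
    IsClosed {x : Lp ℝ 2 P | HasGaussianLaw x P} := by
  have h1 : {x : Lp ℝ 2 P | HasGaussianLaw x P} = ⋂ t : ℝ, {x : Lp ℝ 2 P |
      charFun (P.map x) t = Complex.exp ((t * ∫ ω, x ω ∂P : ℝ) * Complex.I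
        - (t ^ 2 * (‖x‖ ^ 2 - (∫ ω, x ω ∂P) ^ 2) : ℝ) / 2)} := by
    ext x
    rw [mem_ofPred_eq, mem_iInter,
      hasGaussianLaw_iff_charFun_map_eq (Lp.aestronglyMeasurable x).aemeasurable]
    refine forall_congr' fun t => ?_
    rw [mem_ofPred_eq]
    have e1 : (fun ω => inner ℝ t (x ω)) = fun ω => t * x ω := by
      ext ω
      simp [mul_comm]
    rw [e1, integral_const_mul, variance_const_mul, variance_eq_sub (Lp.memLp x)]
    simp only [Pi.pow_apply, integral_Lp_sq_eq]
  rw [h1]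
  refine isClosed_iInter fun t => isClosed_eq (continuous_charFun_Lp_two t) ?_
  have := continuous_integral_Lp_two (P := P)
  fun_prop

/-- A square-integrable random variable that is orthogonal to everything orthogonal to the
constants and to a Gaussian process is Gaussian. -/
theorem hasGaussianLaw_of_orthogonal {T : Type*} {G : T → Ω → ℝ} (hG : IsGaussianProcess G P)
    {C : Ω → ℝ} (hC : MemLp C 2 P)
    (h : ∀ ξ : Ω → ℝ, MemLp ξ 2 P → ∫ ω, ξ ω ∂P = 0 → (∀ t, ∫ ω, G t ω * ξ ω ∂P = 0) →
      ∫ ω, C ω * ξ ω ∂P = 0) : HasGaussianLaw C P := by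
  have := hG.isProbabilityMeasure
  have hGm (t : T) : MemLp (G t) 2 P := (hG.hasGaussianLaw_eval t).memLp_two
  let one : Lp ℝ 2 P := (memLp_const (1 : ℝ)).toLp
  have hone : one =ᵐ[P] fun _ => (1 : ℝ) := MemLp.coeFn_toLp _
  let K : Submodule ℝ (Lp ℝ 2 P) :=
    Submodule.span ℝ (insert one (range fun t => (hGm t).toLp))
  have hK (x : Lp ℝ 2 P) (hx : x ∈ K) : ∃ (c : ℝ) (l : T →₀ ℝ),
      x =ᵐ[P] fun ω => l.sum (fun t r => r • G t ω) + c := by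
    refine Submodule.span_induction ?_ ?_ ?_ ?_ hx
    · rintro x (rfl | ⟨t, rfl⟩)
      · exact ⟨1, 0, by simpa using hone⟩
      · refine ⟨0, Finsupp.single t 1, ?_⟩
        simpa using MemLp.coeFn_toLp (hGm t)
    · exact ⟨0, 0, .of_forall fun ω => by simp⟩
    · rintro x y - - ⟨c, l, hl⟩ ⟨d, m, hm⟩
      refine ⟨c + d, l + m, ?_⟩
      filter_upwards [hl, hm, Lp.coeFn_add x y] with ω h1 h2 h3
      rw [h3, Pi.add_apply, h1, h2, Finsupp.sum_add_index' (by simp) (by simp [add_mul])]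
      ring
    · rintro r x - ⟨c, l, hl⟩
      refine ⟨r * c, r • l, ?_⟩
      filter_upwards [hl, Lp.coeFn_smul r x] with ω h1 h2
      rw [h2, Pi.smul_apply, h1, Finsupp.sum_smul_index' (by simp), smul_eq_mul, mul_add,
        Finsupp.mul_sum]
      simp [mul_assoc]
  have hKG : (K : Set (Lp ℝ 2 P)) ⊆ {x : Lp ℝ 2 P | HasGaussianLaw x P} := by
    intro x hx
    obtain ⟨c, l, hl⟩ := hK x hx
    have h1 : HasGaussianLaw (fun ω => l.sum fun t r => r • G t ω) P :=
      (hG.smul fun t => l t).hasGaussianLaw_fun_sum (I := l.support)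
    have h2 : HasLaw _ _ P := ⟨h1.aemeasurable, h1.map_eq_gaussianReal⟩
    exact (gaussianReal_add_const h2 c).hasGaussianLaw.congr hl.symm
  have hmem : hC.toLp ∈ K.topologicalClosure := by
    rw [← Submodule.orthogonal_orthogonal_eq_closure, Submodule.mem_orthogonal']
    intro ξ hξ
    rw [Submodule.mem_orthogonal] at hξ
    have h0 := h ξ (Lp.memLp ξ) ?_ fun t => ?_
    · rw [L2.inner_def, ← h0]
      refine integral_congr_ae ((MemLp.coeFn_toLp hC).mono fun ω hω => ?_)
      simp [hω, mul_comm]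
    · rw [← hξ one (Submodule.subset_span (mem_insert _ _)), L2.inner_def]
      refine integral_congr_ae (hone.mono fun ω hω => ?_)
      simp [hω]
    · rw [← hξ _ (Submodule.subset_span (mem_insert_of_mem _ ⟨t, rfl⟩)), L2.inner_def]
      refine integral_congr_ae ((MemLp.coeFn_toLp (hGm t)).mono fun ω hω => ?_)
      simp [hω, mul_comm]
  exact HasGaussianLaw.congr (closure_minimal hKG isClosed_hasGaussianLaw hmem)
    (MemLp.coeFn_toLp hC)

theorem IsForcedProcess.exists_limit_memLp [IsProbabilityMeasure P] {a b y i : ℝ} (ha : 0 < a)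
    {f Y I : ℝ → Ω → ℝ} (h : IsForcedProcess P a b f Y I y i) :
    ∃ C : Ω → ℝ, Measurable C ∧ MemLp C 2 P ∧
      (∀ᵐ ω ∂P, Tendsto (fun t => damp a (b / a) t * Y t ω) atTop (nhds (C ω))) ∧
      (∀ ξ : Ω → ℝ, MemLp ξ 2 P → Tendsto (fun t => damp a (b / a) t * ∫ ω, Y t ω * ξ ω ∂P) atTop
        (nhds (∫ ω, C ω * ξ ω ∂P))) ∧
      Tendsto (fun t => ∫ ω, (damp a (b / a) t * Y t ω) ^ 2 ∂P) atTop
        (nhds (∫ ω, C ω ^ 2 ∂P)) := by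
  obtain ⟨C, hCm, hC⟩ := h.exists_limit ha
  obtain ⟨Z, hZ, hb⟩ := h.exists_bound ha
  have hle {t : ℝ} (ht : 0 ≤ t) : ∀ᵐ ω ∂P, |damp a (b / a) t * Y t ω| ≤ Z ω := by
    filter_upwards [hb] with ω hω
    rw [abs_mul, abs_of_pos (damp_pos _ _ _)]
    exact (hω.2 t ht).1
  have hCZ : ∀ᵐ ω ∂P, |C ω| ≤ Z ω := by
    filter_upwards [hC, hb] with ω hω hbω
    refine le_of_tendsto hω.abs ((eventually_ge_atTop 0).mono fun t ht => ?_)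
    rw [abs_mul, abs_of_pos (damp_pos _ _ _)]
    exact (hbω.2 t ht).1
  refine ⟨C, hCm, hZ.mono' hCm.aestronglyMeasurable hCZ, hC, fun ξ hξ => ?_, ?_⟩
  · simp only [← integral_const_mul, ← mul_assoc]
    refine tendsto_integral_filter_of_dominated_convergence (fun ω => Z ω * |ξ ω|)
      (Eventually.of_forall fun t =>
        ((h.mY t).const_mul _).aestronglyMeasurable.mul hξ.aestronglyMeasurable)
      ((eventually_ge_atTop 0).mono fun t ht => ?_) (hZ.integrable_mul hξ.abs)
      (hC.mono fun ω hω => hω.mul_const _)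
    filter_upwards [hle ht] with ω hω
    rw [norm_mul]
    exact mul_le_mul_of_nonneg_right hω (abs_nonneg _)
  · refine tendsto_integral_filter_of_dominated_convergence (fun ω => Z ω ^ 2)
      (Eventually.of_forall fun t => (((h.mY t).const_mul _).pow_const 2).aestronglyMeasurable)
      ((eventually_ge_atTop 0).mono fun t ht => ?_) hZ.integrable_sq
      (hC.mono fun ω hω => hω.pow 2)
    filter_upwards [hle ht] with ω hω
    rw [norm_pow]
    exact pow_le_pow_left₀ (abs_nonneg _) hω 2

theorem IsForcedProcess.memLp_Y [IsProbabilityMeasure P] {a b y i : ℝ} (ha : 0 < a)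
    {f Y I : ℝ → Ω → ℝ} (h : IsForcedProcess P a b f Y I y i) {t : ℝ} (ht : 0 ≤ t) :
    MemLp (Y t) 2 P := by
  obtain ⟨Z, hZ, hb⟩ := h.exists_bound ha
  exact (memLp_of_damp_bound (h.mY t) hZ (hb.mono fun ω hω => (hω.2 t ht).1)).1

theorem IsForcedProcess.tendsto_integral_sq_add [IsProbabilityMeasure P] {a b y i : ℝ}
    (ha : 0 < a) {f Y I : ℝ → Ω → ℝ} (h : IsForcedProcess P a b f Y I y i) {l : ℝ}
    (hl : Tendsto (fun t => ∫ ω, (damp a (b / a) t * Y t ω) ^ 2 ∂P) atTop (nhds l)) :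
    Tendsto (fun t => damp a (b / a) t ^ 2 * ∫ ω, (Y t ω + f t ω) ^ 2 ∂P) atTop (nhds l) := by
  obtain ⟨c, hc⟩ := h.sq_le
  have hd0 : Tendsto (damp a (b / a)) atTop (nhds 0) := by
    simpa using tendsto_rpow_mul_damp ha (b / a) 0
  have hd1 : Tendsto (fun t => t * damp a (b / a) t) atTop (nhds 0) := by
    simpa using tendsto_rpow_mul_damp ha (b / a) 1
  have herr : Tendsto (fun t => damp a (b / a) t * (∫ ω, (damp a (b / a) t * Y t ω) ^ 2 ∂P)
      + (1 + damp a (b / a) t) * (c * (t * damp a (b / a) t))) atTop (nhds 0) := by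
    simpa using (hd0.mul hl).add ((hd0.const_add 1).mul (hd1.const_mul c))
  have hdiff := squeeze_zero_norm' (a := fun t => damp a (b / a) t
      * (∫ ω, (damp a (b / a) t * Y t ω) ^ 2 ∂P)
      + (1 + damp a (b / a) t) * (c * (t * damp a (b / a) t))) (t₀ := atTop)
    (f := fun t => damp a (b / a) t ^ 2 * (∫ ω, (Y t ω + f t ω) ^ 2 ∂P)
      - ∫ ω, (damp a (b / a) t * Y t ω) ^ 2 ∂P)
    ((eventually_ge_atTop 0).mono fun t ht => ?_) herr
  · simpa using hdiff.add hl
  set d := damp a (b / a) t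
  have hdpos : 0 < d := damp_pos _ _ _
  have hYL := h.memLp_Y ha ht
  have hY2 := hYL.integrable_sq
  have hf2 := (h.memLp t).integrable_sq
  have hs2 : Integrable (fun ω => (Y t ω + f t ω) ^ 2) P := (hYL.add (h.memLp t)).integrable_sq
  have hdY2 : Integrable (fun ω => (d * Y t ω) ^ 2) P := (hYL.const_mul d).integrable_sq
  rw [← integral_const_mul, ← integral_sub (hs2.const_mul _) hdY2]
  have hb : ∫ ω, (d * (d * Y t ω) ^ 2 + (1 + d) * d * f t ω ^ 2) ∂P
      ≤ d * (∫ ω, (d * Y t ω) ^ 2 ∂P) + (1 + d) * (c * (t * d)) := by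
    rw [integral_add (hdY2.const_mul _) (hf2.const_mul _), integral_const_mul,
      integral_const_mul]
    nlinarith [mul_le_mul_of_nonneg_left (hc t ht) (by positivity : 0 ≤ (1 + d) * d)]
  refine (norm_integral_le_of_norm_le ((hdY2.const_mul _).add (hf2.const_mul _))
    (Eventually.of_forall fun ω => ?_)).trans hb
  have e : d ^ 2 * (Y t ω + f t ω) ^ 2 - (d * Y t ω) ^ 2
      = d * (2 * (d * Y t ω) * f t ω + d * f t ω ^ 2) := by ring
  have e' : d * (d * Y t ω) ^ 2 + (1 + d) * d * f t ω ^ 2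
      = d * ((d * Y t ω) ^ 2 + f t ω ^ 2 + d * f t ω ^ 2) := by ring
  rw [Pi.add_apply, e, e', norm_mul, Real.norm_of_nonneg hdpos.le]
  refine mul_le_mul_of_nonneg_left (abs_le.2 ⟨?_, ?_⟩) hdpos.le
  · nlinarith [sq_nonneg (d * Y t ω + f t ω), mul_nonneg hdpos.le (sq_nonneg (f t ω))]
  · nlinarith [sq_nonneg (d * Y t ω - f t ω)]

open scoped NNReal in
theorem integral_mul_eval_of_isPreBrownianReal {B : ℝ → Ω → ℝ}
    (hB : IsPreBrownianReal (fun (t : ℝ≥0) ω => B t ω) P) {s t : ℝ} (hs : 0 ≤ s) (ht : 0 ≤ t) :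
    MemLp (B s) 2 P ∧ ∫ ω, B s ω ∂P = 0 ∧ ∫ ω, B s ω * B t ω ∂P = min s t := by
  have := hB.isGaussianProcess.isProbabilityMeasure
  lift s to ℝ≥0 using hs
  lift t to ℝ≥0 using ht
  have hL (t : ℝ≥0) : MemLp (B t) 2 P := (hB.isGaussianProcess.hasGaussianLaw_eval t).memLp_two
  have h0 := hB.integral_eval s
  have h1 := hB.covariance_fun_eval s t
  rw [covariance_eq_sub (hL s) (hL t), h0, zero_mul, sub_zero] at h1
  exact ⟨hL s, h0, by simpa using h1⟩

open scoped NNReal in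
theorem IsForcedProcess.hasGaussianLaw_limit [IsProbabilityMeasure P] {a b y i σ : ℝ}
    (ha : 0 < a) {B Y I : ℝ → Ω → ℝ}
    (hB : IsPreBrownianReal (fun (t : ℝ≥0) ω => B t ω) P)
    (h : IsForcedProcess P a b (fun t ω => σ * B (max t 0) ω) Y I y i) {C : Ω → ℝ}
    (hC : MemLp C 2 P)
    (hlim : ∀ ξ : Ω → ℝ, MemLp ξ 2 P →
      Tendsto (fun t => damp a (b / a) t * ∫ ω, Y t ω * ξ ω ∂P) atTop
        (nhds (∫ ω, C ω * ξ ω ∂P))) :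
    HasGaussianLaw C P := by
  refine hasGaussianLaw_of_orthogonal hB.isGaussianProcess hC fun ξ hξ hξ0 hBξ => ?_
  have hf (t : ℝ) (_ : 0 ≤ t) : ∫ ω, σ * B (max t 0) ω * ξ ω ∂P = 0 := by
    simp only [mul_assoc, integral_const_mul]
    rw [← Real.coe_toNNReal', hBξ, mul_zero]
  obtain ⟨Iu, hsol, hI0⟩ := h.exists_isForcedSol_integral ha hξ hξ0 continuous_const hf
  have hY0 : ∫ ω, Y (max 0 0) ω * ξ ω ∂P = 0 := by
    simp only [max_self, h.Y0, integral_const_mul, hξ0, mul_zero]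
  refine tendsto_nhds_unique (hlim ξ hξ) (tendsto_const_nhds.congr' ?_)
  filter_upwards [eventually_ge_atTop 0] with t ht
  have := forced_eq_zero ha hsol hY0 hI0 ht
  simp only [max_eq_left ht] at this
  rw [this, mul_zero]

open scoped NNReal in
theorem IsForcedProcess.variance_limit_pos [IsProbabilityMeasure P] {a b y i σ : ℝ}
    (ha : 0 < a) (hσ : 0 < σ) {B Y I : ℝ → Ω → ℝ}
    (hB : IsPreBrownianReal (fun (t : ℝ≥0) ω => B t ω) P)
    (h : IsForcedProcess P a b (fun t ω => σ * B (max t 0) ω) Y I y i) {C : Ω → ℝ}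
    (hC : MemLp C 2 P)
    (hlim : ∀ ξ : Ω → ℝ, MemLp ξ 2 P →
      Tendsto (fun t => damp a (b / a) t * ∫ ω, Y t ω * ξ ω ∂P) atTop
        (nhds (∫ ω, C ω * ξ ω ∂P))) :
    0 < variance C P := by
  obtain ⟨T, hT, hnot⟩ := not_tendsto_zero_of_late_forcing b ha
  have hT1 : 0 ≤ T + 1 := by linarith
  obtain ⟨hL1, hm1, -⟩ := integral_mul_eval_of_isPreBrownianReal hB hT1 hT1
  obtain ⟨hL0, hm0, -⟩ := integral_mul_eval_of_isPreBrownianReal hB hT.le hT.le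
  set ξ : Ω → ℝ := fun ω => B (T + 1) ω - B T ω
  have hξ : MemLp ξ 2 P := hL1.sub hL0
  have hξ0 : ∫ ω, ξ ω ∂P = 0 := by
    rw [integral_sub (hL1.integrable one_le_two) (hL0.integrable one_le_two), hm1, hm0, sub_zero]
  let fu : ℝ → ℝ := fun t => σ * (min (max t 0) (T + 1) - min (max t 0) T)
  have hfu : Continuous fu := by fun_prop
  have hfu0 (t : ℝ) : 0 ≤ fu t :=
    mul_nonneg hσ.le (sub_nonneg.2 (min_le_min_left _ (by linarith)))
  have hfu1 (t : ℝ) : fu t ≤ σ := by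
    have : min (max t 0) (T + 1) ≤ min (max t 0) T + 1 := by
      rw [← min_add_add_right]
      exact min_le_min_right _ (by linarith)
    nlinarith
  have hf (t : ℝ) (_ : 0 ≤ t) : ∫ ω, σ * B (max t 0) ω * ξ ω ∂P = fu t := by
    obtain ⟨hLt, -, h1⟩ := integral_mul_eval_of_isPreBrownianReal hB (le_max_right t 0) hT1
    obtain ⟨-, -, h0⟩ := integral_mul_eval_of_isPreBrownianReal hB (le_max_right t 0) hT.le
    have i1 : Integrable (fun ω => σ * (B (max t 0) ω * B (T + 1) ω)) P :=
      (hLt.integrable_mul hL1).const_mul σ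
    have i0 : Integrable (fun ω => σ * (B (max t 0) ω * B T ω)) P :=
      (hLt.integrable_mul hL0).const_mul σ
    simp only [fu, ξ, mul_assoc, mul_sub]
    rw [integral_sub i1 i0, integral_const_mul, integral_const_mul, h1, h0]
  obtain ⟨Iu, hsol, hI0⟩ := h.exists_isForcedSol_integral ha hξ hξ0 hfu hf
  have hY0 : ∫ ω, Y (max 0 0) ω * ξ ω ∂P = 0 := by
    simp only [max_self, h.Y0, integral_const_mul, hξ0, mul_zero]
  refine (variance_nonneg C P).lt_of_ne' fun hv => ?_
  have hCξ : ∫ ω, C ω * ξ ω ∂P = 0 := by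
    rw [integral_congr_ae (g := fun ω => (∫ ω', C ω' ∂P) * ξ ω), integral_const_mul, hξ0,
      mul_zero]
    filter_upwards [(ae_eq_integral_of_variance_eq_zero hC hv)] with ω hω
    rw [hω]
  refine hnot fu _ Iu hsol hY0 hI0 hfu0 (fun t ht htT => ?_) ?_ ⟨T + 1, by linarith, ?_⟩ ?_
  · simp only [fu, max_eq_left ht, min_eq_left htT,
      min_eq_left (htT.trans (le_add_of_nonneg_right zero_le_one)), sub_self, mul_zero]
  · refine ((integrableOn_damp ha (b / a)).mul_const σ).mono' ?_
      (Eventually.of_forall fun t => ?_)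
    · exact ((continuous_damp a (b / a)).mul hfu.abs).aestronglyMeasurable
    · rw [norm_mul, Real.norm_of_nonneg (damp_pos _ _ _).le, norm_abs_eq_norm,
        Real.norm_of_nonneg (hfu0 t)]
      exact mul_le_mul_of_nonneg_left (hfu1 t) (damp_pos _ _ _).le
  · simp [fu, hT1, hσ]
  · have hl := hlim ξ hξ
    rw [hCξ] at hl
    refine hl.congr' ?_
    filter_upwards [eventually_ge_atTop 0] with t ht
    rw [max_eq_left ht]

theorem measurable_intervalIntegral_of_continuous {g : ℝ → Ω → ℝ} (hm : ∀ s, Measurable (g s))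
    (hc : ∀ ω, Continuous fun s => g s ω) (u v : ℝ) :
    Measurable fun ω => ∫ s in u..v, g s ω := by
  have h : StronglyMeasurable fun p : Ω × ℝ => g p.2 p.1 :=
    ((measurable_uncurry_of_continuous_of_measurable (u := g) hc hm).comp
      measurable_swap).stronglyMeasurable
  simp only [intervalIntegral]
  exact h.integral_prod_right'.measurable.sub h.integral_prod_right'.measurable

open scoped NNReal in
theorem IsSolutionSFDE.exists_isForcedProcess {F : Filtration ℝ mΩ} {a b σ : ℝ} {ψ : ℝ → ℝ}
    {B X : ℝ → Ω → ℝ} (hBP : IsPreBrownianReal (fun (t : ℝ≥0) ω => B t ω) P)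
    (hBm : ∀ t, Measurable (B t)) (hBc : ∀ ω, Continuous fun t => B t ω)
    (hX : IsSolutionSFDE P F a b σ ψ B X) :
    ∃ (Y I : ℝ → Ω → ℝ) (y i : ℝ),
      IsForcedProcess P a b (fun t ω => σ * B (max t 0) ω) Y I y i ∧
      ∀ᵐ ω ∂P, ∀ t, 0 ≤ t → X t ω = Y t ω + σ * B t ω := by
  obtain ⟨hXm, hXc, hXs⟩ := hX
  set i := ∫ u in (-1:ℝ)..0, ψ u
  have hmax : Continuous fun t : ℝ => max t 0 := by fun_prop
  have hw : Continuous fun s : ℝ => b / (1 + |s|) := by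
    have : ∀ s : ℝ, 1 + |s| ≠ 0 := fun s => by positivity
    fun_prop (disch := exact this _)
  let X' : ℝ → Ω → ℝ := fun t ω => X (max t 0) ω
  have mX (t : ℝ) : Measurable (X' t) :=
    (hXm _ (le_max_right t 0)).measurable.mono (F.le _) le_rfl
  have cX (ω : Ω) : Continuous fun t => X' t ω :=
    (hXc ω).comp_continuous hmax fun t => le_max_right t 0
  let I : ℝ → Ω → ℝ := fun t ω => i + ∫ s in (0:ℝ)..t, X' s ω
  have mI (t : ℝ) : Measurable (I t) :=
    (measurable_intervalIntegral_of_continuous mX cX 0 t).const_add i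
  have cI (ω : Ω) : Continuous fun t => I t ω :=
    (intervalIntegral.continuous_primitive
      (fun u v => (cX ω).intervalIntegrable u v) 0).const_add i
  let g : ℝ → Ω → ℝ := fun s ω => a * X' s ω + b / (1 + |s|) * I s ω
  have mg (s : ℝ) : Measurable (g s) := ((mX s).const_mul a).add ((mI s).const_mul _)
  have cg (ω : Ω) : Continuous fun s => g s ω := ((cX ω).const_mul a).add (hw.mul (cI ω))
  let Y : ℝ → Ω → ℝ := fun t ω => ψ 0 + ∫ s in (0:ℝ)..t, g s ω
  have hXY : ∀ᵐ ω ∂P, ∀ t, 0 ≤ t → X t ω = Y t ω + σ * B t ω := by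
    filter_upwards [hXs] with ω hω t ht
    rw [hω t ht]
    congr 2
    refine intervalIntegral.integral_congr fun s hs => ?_
    rw [uIcc_of_le ht] at hs
    have e : ∫ u in (0:ℝ)..s, X u ω = ∫ u in (0:ℝ)..s, X' u ω := by
      refine intervalIntegral.integral_congr fun u hu => ?_
      rw [uIcc_of_le hs.1] at hu
      simp only [X', max_eq_left hu.1]
    simp only [g, I, X', max_eq_left hs.1, abs_of_nonneg hs.1, e]
  have hBL (t : ℝ) : MemLp (B (max t 0)) 2 P :=
    (integral_mul_eval_of_isPreBrownianReal hBP (le_max_right t 0) le_rfl).1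
  refine ⟨Y, I, ψ 0, i, ⟨fun t => (hBm _).const_mul σ, fun t => ?_, mI,
    fun ω => ((hBc ω).comp hmax).const_mul σ, fun ω => ?_, cI, fun ω => ?_, fun ω => ?_, ?_,
    fun t => (hBL t).const_mul σ, σ ^ 2, fun t ht => ?_⟩, hXY⟩
  · exact (measurable_intervalIntegral_of_continuous mg cg 0 t).const_add _
  · exact (intervalIntegral.continuous_primitive
      (fun u v => (cg ω).intervalIntegrable u v) 0).const_add _
  · simp only [Y, intervalIntegral.integral_same, add_zero]
  · simp only [I, intervalIntegral.integral_same, add_zero]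
  · filter_upwards [hXY] with ω hω
    refine ⟨((hBc ω).comp hmax).const_mul σ, (intervalIntegral.continuous_primitive
      (fun u v => (cg ω).intervalIntegrable u v) 0).const_add _, cI ω, fun t ht => ?_,
      fun t ht => ?_⟩
    · refine (((cg ω).integral_hasStrictDerivAt 0 t).hasDerivAt.const_add (ψ 0)).congr_deriv ?_
      simp only [g, X', max_eq_left ht.le, abs_of_pos ht, hω t ht.le]
      ring
    · refine (((cX ω).integral_hasStrictDerivAt 0 t).hasDerivAt.const_add i).congr_deriv ?_
      simp only [X', max_eq_left ht.le, hω t ht.le]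
  · have h1 := (integral_mul_eval_of_isPreBrownianReal hBP ht ht).2.2
    simp only [max_eq_left ht, mul_pow, integral_const_mul]
    simp only [sq (B t _), h1, min_self]
    exact le_rfl

theorem div_exp_mul_rpow (a β x : ℝ) {t : ℝ} (ht : 0 < t) :
    x / (exp (a * t) * t ^ β) = (t / (1 + t)) ^ (-β) * (damp a β t * x) := by
  have h1 : 0 < 1 + t := by linarith
  have h2 := rpow_pos_of_pos ht β
  have h3 := rpow_pos_of_pos h1 β
  rw [damp, abs_of_pos ht, div_rpow ht.le h1.le, rpow_neg ht.le, rpow_neg h1.le, exp_neg]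
  field_simp

theorem tendsto_div_exp_mul_rpow (a β : ℝ) {u : ℝ → ℝ} {l : ℝ}
    (hu : Tendsto (fun t => damp a β t * u t) atTop (nhds l)) :
    Tendsto (fun t => u t / (exp (a * t) * t ^ β)) atTop (nhds l) := by
  have h1 := (tendsto_div_one_add_rpow (-β)).mul hu
  rw [one_mul] at h1
  refine h1.congr' ((eventually_gt_atTop 0).mono fun t ht => ?_)
  beta_reduce
  rw [div_exp_mul_rpow a β (u t) ht]

theorem tendsto_div_exp_mul_rpow_sq (a β : ℝ) {u : ℝ → ℝ} {l : ℝ}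
    (hu : Tendsto (fun t => damp a β t ^ 2 * u t) atTop (nhds l)) :
    Tendsto (fun t => u t / (exp (a * t) * t ^ β) ^ 2) atTop (nhds l) := by
  have h1 := ((tendsto_div_one_add_rpow (-β)).pow 2).mul hu
  rw [one_pow, one_mul] at h1
  refine h1.congr' ((eventually_gt_atTop 0).mono fun t ht => ?_)
  beta_reduce
  have h2 := div_exp_mul_rpow a β 1 ht
  rw [mul_one] at h2
  rw [← mul_assoc, ← mul_pow, ← h2, one_div, inv_pow, inv_mul_eq_div]

end ForcedProcess

theorem sfde_exp_growth {Ω : Type*} {mΩ : MeasurableSpace Ω} (P : Measure Ω) [IsProbabilityMeasure P]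
    (F : MeasureTheory.Filtration ℝ mΩ) (a b σ : ℝ) (ψ : ℝ → ℝ) (B X : ℝ → Ω → ℝ)
    (hσ : 0 < σ) (hψ : ContinuousOn ψ (Set.Icc (-1 : ℝ) 0))
    (hB : IsStdBrownian P F B) (hX : IsSolutionSFDE P F a b σ ψ B X)
    (ha : 0 < a) :
    ∃ C : Ω → ℝ, Measurable C ∧
      (∃ m : ℝ, ∃ v : NNReal, 0 < v ∧ P.map C = gaussianReal m v) ∧
      (∀ᵐ ω ∂P, Filter.Tendsto (fun t : ℝ => X t ω / (Real.exp (a * t) * t ^ (b / a)))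
        Filter.atTop (nhds (C ω))) ∧
      Filter.Tendsto (fun t : ℝ => (∫ ω, X t ω ∂P) / (Real.exp (a * t) * t ^ (b / a)))
        Filter.atTop (nhds (∫ ω, C ω ∂P)) ∧
      Filter.Tendsto (fun t : ℝ => variance (X t) P / (Real.exp (2 * a * t) * t ^ (2 * b / a)))
        Filter.atTop (nhds (variance C P)) := by
  have hBP := hB.isPreBrownianReal
  obtain ⟨Y, I, y, i, h, hXY⟩ := hX.exists_isForcedProcess hBP
    (fun t => (hB.1 t).mono (F.le t) le_rfl) hB.2.2.1
  obtain ⟨C, hCm, hC2, hClim, hCξ, hCsq⟩ := h.exists_limit_memLp ha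
  have hgauss := h.hasGaussianLaw_limit ha hBP hC2 hCξ
  have hvar := h.variance_limit_pos ha hσ hBP hC2 hCξ
  have hXae {t : ℝ} (ht : 0 ≤ t) : X t =ᵐ[P] fun ω => Y t ω + σ * B (max t 0) ω := by
    filter_upwards [hXY] with ω hω
    rw [hω t ht, max_eq_left ht]
  have hmeanX {t : ℝ} (ht : 0 ≤ t) : ∫ ω, X t ω ∂P = ∫ ω, Y t ω ∂P := by
    rw [integral_congr_ae (hXae ht), integral_add ((h.memLp_Y ha ht).integrable one_le_two)
      ((h.memLp t).integrable one_le_two), integral_const_mul,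
      (integral_mul_eval_of_isPreBrownianReal hBP (le_max_right t 0) le_rfl).2.1, mul_zero,
      add_zero]
  have hmean : Tendsto (fun t => damp a (b / a) t * ∫ ω, X t ω ∂P) atTop
      (nhds (∫ ω, C ω ∂P)) := by
    have h1 := hCξ (fun _ => 1) (memLp_const 1)
    simp only [mul_one] at h1
    refine h1.congr' ((eventually_ge_atTop 0).mono fun t ht => ?_)
    beta_reduce
    rw [hmeanX ht]
  refine ⟨C, hCm, ⟨_, _, Real.toNNReal_pos.2 hvar, hgauss.map_eq_gaussianReal⟩, ?_,
    tendsto_div_exp_mul_rpow a (b / a) hmean, ?_⟩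
  · filter_upwards [hClim, hXY, hB.ae_tendsto_damp_mul ha (b / a)] with ω h1 h2 h3
    refine tendsto_div_exp_mul_rpow a (b / a) ?_
    have h4 := h1.add (h3.const_mul σ)
    rw [mul_zero, add_zero] at h4
    refine h4.congr' ((eventually_ge_atTop 0).mono fun t ht => ?_)
    beta_reduce
    rw [h2 t ht]
    ring
  · have hsq : Tendsto (fun t => damp a (b / a) t ^ 2 * variance (X t) P) atTop
        (nhds (variance C P)) := by
      rw [variance_eq_sub hC2]
      refine ((h.tendsto_integral_sq_add ha hCsq).sub (hmean.pow 2)).congr'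
        ((eventually_ge_atTop 0).mono fun t ht => ?_)
      have hL : MemLp (X t) 2 P := ((h.memLp_Y ha ht).add (h.memLp t)).ae_eq (hXae ht).symm
      have e : ∫ ω, (X t ^ 2) ω ∂P = ∫ ω, (Y t ω + σ * B (max t 0) ω) ^ 2 ∂P := by
        refine integral_congr_ae ((hXae ht).mono fun ω hω => ?_)
        simp only [Pi.pow_apply, hω]
      beta_reduce
      rw [variance_eq_sub hL, e]
      ring
    refine (tendsto_div_exp_mul_rpow_sq a (b / a) hsq).congr'
      ((eventually_gt_atTop 0).mono fun t ht => ?_)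
    beta_reduce
    rw [mul_pow, ← exp_nat_mul, ← rpow_mul_natCast ht.le]
    push_cast
    ring_nf
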